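/- arXiv:1308.6473 — 4 statements merged into one kernel-verified Lean document; each statement's English description precedes it below -/
import Mathlib

section
/- For all (a1,a2,a3,a4,a5,a6) and (i1,i2,i3,i4,i5,i6) in ℕ^6, the following identity holds in ℚ(q) (both sums have finitely many nonzero terms, by the conservation conditions built into the Kronecker deltas in R): Σ_{j1,j2,j3,j4,j5,j6 ≥ 0} R^{a1,a2,a4}_{j1,j2,j4} R^{j1,a3,a5}_{i1,j3,j5} R^{j2,j3,a6}_{i2,i3,j6} R^{j4,j5,j6}_{i4,i5,i6} = Σ_{j1,j2,j3,j4,j5,j6 ≥ 0} R^{a4,a5,a6}_{j4,j5,j6} R^{a2,a3,j6}_{j2,j3,i6} R^{a1,j3,j5}_{j1,i3,i5} R^{j1,j2,j4}_{i1,i2,i4}. This is the component form of the tetrahedron equation R_{124} R_{135} R_{236} R_{456} = R_{456} R_{236} R_{135} R_{124} for the 3d R matrix acting on the tensor cube of the Fock space F = ⊕_{m≥0} ℚ(q)|m⟩. -/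
/- Tetrahedron equation (component form) for the 3d R matrix of the q-oscillator /
   quantized coordinate ring, over K = ℚ(q). -/

noncomputable section
open Finset

/-- `(x;p)_m = ∏_{j=1}^m (1 - x p^{j-1})`. -/
def poch {K : Type} [Field K] (x p : K) (m : ℕ) : K := ∏ j ∈ range m, (1 - x * p ^ j)

/-- Gaussian binomial `binom(m,n)_p`, zero unless `0 ≤ n ≤ m`. -/
def qbinom {K : Type} [Field K] (p : K) (m n : ℕ) : K :=
  if n ≤ m then poch p p m / (poch p p n * poch p p (m - n)) else 0

/-- The 3d R matrix element `R^{a,b,c}_{i,j,k}`: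
`δ_{a+b,i+j} δ_{b+c,j+k} Σ_{λ+μ=b} (-1)^λ q^{i(c-j)+(k+1)λ+μ(μ-k)}
 ((q²;q²)_{c+μ}/(q²;q²)_c) binom(i,μ)_{q²} binom(j,λ)_{q²}` (here `μ = b - λ`). -/
def R3 {K : Type} [Field K] (q : K) (a b c i j k : ℕ) : K :=
  if a + b = i + j ∧ b + c = j + k then
    ∑ l ∈ range (b + 1),
      (-1 : K) ^ l *
        q ^ ((i : ℤ) * ((c : ℤ) - (j : ℤ)) + ((k : ℤ) + 1) * (l : ℤ)
            + ((b : ℤ) - (l : ℤ)) * ((b : ℤ) - (l : ℤ) - (k : ℤ))) *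
        (poch (q ^ 2) (q ^ 2) (c + (b - l)) / poch (q ^ 2) (q ^ 2) c) *
        qbinom (q ^ 2) i (b - l) * qbinom (q ^ 2) j l
  else 0


section QuantumAlgebra

variable {K : Type} [Field K] {q : K}

/-- Generic deformation parameter: `q` is neither zero nor a root of unity. -/
structure IsGeneric (q : K) : Prop where
  ne_zero : q ≠ 0
  one_sub_ne_zero : ∀ n : ℕ, 1 - (q ^ 2) ^ (n + 1) ≠ 0

theorem IsGeneric.one_sub_sq_ne_zero (hq : IsGeneric q) : 1 - q ^ 2 ≠ 0 := by
  simpa using hq.one_sub_ne_zero 0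

theorem poch_succ (q : K) (n : ℕ) :
    poch (q ^ 2) (q ^ 2) (n + 1) = poch (q ^ 2) (q ^ 2) n * (1 - (q ^ 2) ^ (n + 1)) := by
  rw [poch, prod_range_succ, ← poch, ← pow_succ']

theorem poch_zero (q : K) : poch (q ^ 2) (q ^ 2) 0 = 1 := by
  simp [poch]

theorem IsGeneric.poch_ne_zero (hq : IsGeneric q) (n : ℕ) : poch (q ^ 2) (q ^ 2) n ≠ 0 := by
  induction n with
  | zero => simp [poch_zero]
  | succ n ih => rw [poch_succ]; exact mul_ne_zero ih (hq.one_sub_ne_zero n)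

theorem qbinom_eq_zero {p : K} {m n : ℕ} (h : m < n) : qbinom p m n = 0 := by
  rw [qbinom, if_neg (by omega)]

theorem qbinom_zero_right (hq : IsGeneric q) (m : ℕ) : qbinom (q ^ 2) m 0 = 1 := by
  simp [qbinom, poch_zero, hq.poch_ne_zero]

theorem qbinom_pascal (hq : IsGeneric q) {m n : ℕ} (h : n ≤ m) :
    qbinom (q ^ 2) (m + 1) (n + 1) =
      qbinom (q ^ 2) m (n + 1) + (q ^ 2) ^ (m - n) * qbinom (q ^ 2) m n := by
  obtain ⟨d, rfl⟩ := Nat.exists_eq_add_of_le h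
  have hn := hq.poch_ne_zero n
  have hn' := hq.one_sub_ne_zero n
  have hd' := hq.one_sub_ne_zero d
  cases d with
  | zero =>
    have := hq.poch_ne_zero (n + 1)
    simp [qbinom, poch_zero, hn, this]
  | succ d =>
    have hd := hq.poch_ne_zero d
    have hd'' := hq.one_sub_ne_zero d
    rw [qbinom, qbinom, qbinom, if_pos (by omega), if_pos (by omega), if_pos (by omega),
      show n + (d + 1) + 1 - (n + 1) = d + 1 by omega,
      show n + (d + 1) - (n + 1) = d by omega, show n + (d + 1) - n = d + 1 by omega,
      poch_succ, poch_succ q n, poch_succ q d]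
    field_simp
    ring

/-- `binom(m,n) (q²;q²)_n` is the falling `q`-factorial. -/
theorem qbinom_mul_poch_succ (hq : IsGeneric q) {m n : ℕ} (h : n ≤ m) :
    qbinom (q ^ 2) m (n + 1) * poch (q ^ 2) (q ^ 2) (n + 1) =
      (1 - (q ^ 2) ^ (m - n)) * (qbinom (q ^ 2) m n * poch (q ^ 2) (q ^ 2) n) := by
  obtain ⟨d, rfl⟩ := Nat.exists_eq_add_of_le h
  have hn := hq.poch_ne_zero n
  have hn' := hq.one_sub_ne_zero n
  cases d with
  | zero => simp [qbinom_eq_zero]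
  | succ d =>
    have hd := hq.poch_ne_zero d
    have hd' := hq.one_sub_ne_zero d
    rw [qbinom, qbinom, if_pos (by omega), if_pos (by omega),
      show n + (d + 1) - (n + 1) = d by omega, show n + (d + 1) - n = d + 1 by omega,
      poch_succ q n, poch_succ q d]
    field_simp

variable {A : Type*} [Ring A] [Algebra K A]

/-- The relations between the root vectors `x`, `z`, `y` of a rank two subsystem of type `A₂`. -/
structure IsRootTriple (q : K) (x y z : A) : Prop where
  mul_eq : y * x = q • (x * y) + (1 - q ^ 2) • z
  zx : z * x = q⁻¹ • (x * z)
  yz : y * z = q⁻¹ • (z * y)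

/-- The normalized power `q^{n(n-1)/2} xⁿ`. -/
def qpow (q : K) (x : A) (n : ℕ) : A := q ^ n.choose 2 • x ^ n

@[simp] theorem qpow_zero (x : A) : qpow q x 0 = 1 := by simp [qpow]

theorem qpow_succ (x : A) (n : ℕ) : qpow q x (n + 1) = q ^ n • (qpow q x n * x) := by
  simp only [qpow, Nat.choose_succ_succ' n 1, Nat.choose_one_right, pow_add, pow_succ,
    smul_mul_assoc, mul_smul]

theorem qpow_mul_self (x : A) (n : ℕ) : qpow q x n * x = x * qpow q x n := by
  simp [qpow, ← pow_succ, ← pow_succ']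

theorem qpow_succ' (x : A) (n : ℕ) : qpow q x (n + 1) = q ^ n • (x * qpow q x n) := by
  rw [qpow_succ, qpow_mul_self]

theorem qpow_add (x : A) (m n : ℕ) :
    qpow q x (m + n) = q ^ (m * n) • (qpow q x m * qpow q x n) := by
  induction n with
  | zero => simp
  | succ n ih =>
    rw [← add_assoc, qpow_succ, ih, qpow_succ]
    simp only [smul_mul_assoc, mul_smul_comm, smul_smul, mul_assoc]
    congr 1
    ring

theorem qpow_commute {x y : A} (h : Commute x y) (m n : ℕ) :
    qpow q x m * qpow q y n = qpow q y n * qpow q x m := by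
  simp only [qpow, smul_mul_assoc, mul_smul_comm, (h.pow_pow m n).eq]
  rw [smul_comm]

/-- Powers of `q`-commuting elements `q`-commute. -/
theorem qpow_mul_of_qcomm {x y : A} {c : K} (h : y * x = c • (x * y)) (n : ℕ) :
    qpow q y n * x = c ^ n • (x * qpow q y n) := by
  induction n with
  | zero => simp
  | succ n ih =>
    rw [qpow_succ, smul_mul_assoc, mul_assoc, h, mul_smul_comm, ← mul_assoc, ih]
    simp only [smul_mul_assoc, mul_smul_comm, smul_smul, mul_assoc]
    congr 1
    ring

theorem mul_qpow_of_qcomm {x y : A} {c : K} (h : y * x = c • (x * y)) (n : ℕ) :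
    y * qpow q x n = c ^ n • (qpow q x n * y) := by
  induction n with
  | zero => simp
  | succ n ih =>
    rw [qpow_succ, mul_smul_comm, ← mul_assoc, ih, smul_mul_assoc, mul_assoc, h]
    simp only [smul_mul_assoc, mul_smul_comm, smul_smul, mul_assoc]
    congr 1
    ring

theorem qpow_mul_qpow_of_qcomm {x y : A} {c : K} (h : y * x = c • (x * y)) (m n : ℕ) :
    qpow q y m * qpow q x n = c ^ (m * n) • (qpow q x n * qpow q y m) := by
  rw [pow_mul]
  exact mul_qpow_of_qcomm (qpow_mul_of_qcomm h m) n

namespace IsRootTriple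

variable {x y z : A}

/-- The other choice of root vector in the same rank two subsystem. -/
theorem swap (hq : IsGeneric q) (h : IsRootTriple q x y z) :
    IsRootTriple q y x (x * y - q • z) := by
  have h0 := hq.ne_zero
  refine ⟨?_, ?_, ?_⟩
  · linear_combination (norm := skip) -q • h.mul_eq
    module
  · linear_combination (norm := skip) (-q⁻¹) • (h.mul_eq * y) + h.yz
    simp only [add_mul, mul_sub, sub_mul, smul_mul_assoc, mul_smul_comm, mul_assoc]
    match_scalars <;> field_simp <;> ring
  · linear_combination (norm := skip) (-q⁻¹) • (x * h.mul_eq) + h.zx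
    simp only [mul_add, mul_sub, sub_mul, smul_mul_assoc, mul_smul_comm, mul_assoc]
    match_scalars <;> field_simp <;> ring

theorem qpow_mul (hq : IsGeneric q) (h : IsRootTriple q x y z) (n : ℕ) :
    qpow q y n * x = q ^ n • (x * qpow q y n) + (1 - (q ^ 2) ^ n) • (z * qpow q y (n - 1)) := by
  have h0 := hq.ne_zero
  induction n with
  | zero => simp
  | succ n ih =>
    cases n with
    | zero => simpa [qpow_succ] using h.mul_eq
    | succ n =>
      rw [qpow_succ', smul_mul_assoc, mul_assoc, ih]
      simp only [Nat.add_sub_cancel, mul_add, mul_smul_comm, ← mul_assoc, h.mul_eq, h.yz,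
        add_mul, smul_mul_assoc]
      rw [qpow_succ' y n]
      simp only [mul_assoc, mul_smul_comm]
      match_scalars <;> field_simp <;> ring

/-- Reordering of `yᵐ xⁱ`. -/
theorem qpow_mul_qpow (hq : IsGeneric q) (h : IsRootTriple q x y z) (m i N : ℕ) (hN : i < N) :
    qpow q y m * qpow q x i = ∑ μ ∈ range N,
      (q ^ ((i - μ) * (m - μ)) * qbinom (q ^ 2) i μ *
        (qbinom (q ^ 2) m μ * poch (q ^ 2) (q ^ 2) μ)) •
        (qpow q x (i - μ) * qpow q z μ * qpow q y (m - μ)) := by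
  have h0 := hq.ne_zero
  induction i generalizing N with
  | zero =>
    obtain ⟨M, rfl⟩ := Nat.exists_eq_add_of_lt hN
    rw [Finset.sum_eq_single 0]
    · simp [qbinom_zero_right hq, poch_zero]
    · intro μ _ hμ
      simp [qbinom_eq_zero (p := q ^ 2) (Nat.pos_of_ne_zero hμ)]
    · simp
  | succ i ih =>
    obtain ⟨M, rfl⟩ : ∃ M, N = M + 1 := ⟨N - 1, by omega⟩
    have key : ∀ μ, q ^ i • (((q ^ ((i - μ) * (m - μ)) * qbinom (q ^ 2) i μ *
        (qbinom (q ^ 2) m μ * poch (q ^ 2) (q ^ 2) μ)) •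
        (qpow q x (i - μ) * qpow q z μ * qpow q y (m - μ))) * x) =
        (q ^ ((i + 1 - μ) * (m - μ)) * qbinom (q ^ 2) i μ *
          (qbinom (q ^ 2) m μ * poch (q ^ 2) (q ^ 2) μ)) •
          (qpow q x (i + 1 - μ) * qpow q z μ * qpow q y (m - μ)) +
        (q ^ ((i - μ) * (m - (μ + 1))) * ((q ^ 2) ^ (i - μ) * qbinom (q ^ 2) i μ) *
          (qbinom (q ^ 2) m (μ + 1) * poch (q ^ 2) (q ^ 2) (μ + 1))) •
          (qpow q x (i - μ) * qpow q z (μ + 1) * qpow q y (m - (μ + 1))) := by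
      intro μ
      rcases lt_or_ge i μ with hi | hi
      · simp [qbinom_eq_zero hi]
      rcases lt_or_ge m μ with hm | hm
      · simp [qbinom_eq_zero hm, qbinom_eq_zero (p := q ^ 2) (show m < μ + 1 by omega)]
      obtain ⟨d, rfl⟩ := Nat.exists_eq_add_of_le hi
      obtain ⟨e, rfl⟩ := Nat.exists_eq_add_of_le hm
      rw [qbinom_mul_poch_succ hq hm, show μ + d - μ = d by omega, show μ + e - μ = e by omega,
        show μ + d + 1 - μ = d + 1 by omega, show μ + e - (μ + 1) = e - 1 by omega]
      simp only [smul_mul_assoc]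
      rw [mul_assoc (qpow q x d * qpow q z μ), h.qpow_mul hq, mul_add, mul_smul_comm,
        mul_smul_comm, ← mul_assoc _ x, mul_assoc (qpow q x d) _ x, qpow_mul_of_qcomm h.zx,
        qpow_succ z, qpow_succ x]
      simp only [smul_mul_assoc, mul_smul_comm, smul_smul, mul_assoc, inv_pow]
      rcases e with _ | e
      · simp only [pow_zero, sub_self, mul_zero, zero_smul, zero_mul]
        match_scalars
        field_simp
        ring
      · rw [Nat.add_sub_cancel]
        match_scalars <;> field_simp <;> ring
    rw [qpow_succ x, mul_smul_comm, ← mul_assoc, ih (M + 1) (by omega), sum_mul, smul_sum]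
    simp only [key]
    rw [sum_add_distrib, sum_range_succ', sum_range_succ (n := M), sum_range_succ' (n := M),
      qbinom_eq_zero (show i < M by omega)]
    simp only [mul_zero, zero_mul, zero_smul, add_zero, qbinom_zero_right hq]
    rw [add_right_comm, ← sum_add_distrib]
    congr 1
    refine sum_congr rfl fun μ _ => ?_
    rcases lt_or_ge i μ with hi | hi
    · simp [qbinom_eq_zero hi, qbinom_eq_zero (p := q ^ 2) (show i < μ + 1 by omega),
        qbinom_eq_zero (p := q ^ 2) (show i + 1 < μ + 1 by omega)]
    · rw [qbinom_pascal hq hi, Nat.add_sub_add_right]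
      module

/-- Expansion of `yᵏ z'ʲ`, where `z' = xy - qz`. -/
theorem qpow_mul_qpow_swap (hq : IsGeneric q) (h : IsRootTriple q x y z) (k j N : ℕ)
    (hN : j < N) :
    qpow q y k * qpow q (x * y - q • z) j = ∑ l ∈ range N,
      ((-1) ^ l * q ^ ((k + 1) * l) * qbinom (q ^ 2) j l) •
        (qpow q x (j - l) * qpow q z l * qpow q y (k + j - l)) := by
  have h0 := hq.ne_zero
  induction j generalizing N with
  | zero =>
    rw [Finset.sum_eq_single 0]
    · simp [qbinom_zero_right hq]
    · intro l _ hl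
      simp [qbinom_eq_zero (p := q ^ 2) (Nat.pos_of_ne_zero hl)]
    · simp [hN.ne']
  | succ j ih =>
    obtain ⟨M, rfl⟩ : ∃ M, N = M + 1 := ⟨N - 1, by omega⟩
    have hz : y * (x * y - q • z) = q • ((x * y - q • z) * y) := by
      rw [(h.swap hq).zx, smul_smul, mul_inv_cancel₀ h0, one_smul]
    have key : ∀ l, q ^ j • ((((-1) ^ l * q ^ ((k + 1) * l) * qbinom (q ^ 2) j l) •
        (qpow q x (j - l) * qpow q z l * qpow q y (k + j - l))) * (x * y - q • z)) =
        ((-1) ^ l * q ^ ((k + 1) * l) * qbinom (q ^ 2) j l) •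
          (qpow q x (j + 1 - l) * qpow q z l * qpow q y (k + (j + 1) - l)) +
        ((-1) ^ (l + 1) * q ^ ((k + 1) * (l + 1)) *
          ((q ^ 2) ^ (j - l) * qbinom (q ^ 2) j l)) •
          (qpow q x (j - l) * qpow q z (l + 1) * qpow q y (k + j - l)) := by
      intro l
      rcases lt_or_ge j l with hj | hj
      · simp [qbinom_eq_zero hj]
      obtain ⟨d, rfl⟩ := Nat.exists_eq_add_of_le hj
      rw [show l + d - l = d by omega, show l + d + 1 - l = d + 1 by omega,
        show k + (l + d) - l = k + d by omega, show k + (l + d + 1) - l = k + d + 1 by omega]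
      simp only [smul_mul_assoc]
      rw [mul_assoc (qpow q x d * qpow q z l), qpow_mul_of_qcomm hz, sub_mul, mul_smul_comm,
        mul_sub, mul_assoc x, ← mul_assoc _ x, mul_assoc (qpow q x d) _ x,
        qpow_mul_of_qcomm h.zx, qpow_succ z, qpow_succ x, qpow_succ' y]
      simp only [smul_mul_assoc, mul_smul_comm, mul_assoc, inv_pow]
      match_scalars <;> field_simp <;> ring
    rw [qpow_succ (x * y - q • z), mul_smul_comm, ← mul_assoc, ih (M + 1) (by omega), sum_mul,
      smul_sum]
    simp only [key]
    rw [sum_add_distrib, sum_range_succ', sum_range_succ (n := M), sum_range_succ' (n := M),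
      qbinom_eq_zero (show j < M by omega)]
    simp only [mul_zero, zero_smul, add_zero, qbinom_zero_right hq]
    rw [add_right_comm, ← sum_add_distrib]
    congr 1
    refine sum_congr rfl fun l _ => ?_
    rcases lt_or_ge j l with hj | hj
    · simp [qbinom_eq_zero hj, qbinom_eq_zero (p := q ^ 2) (show j < l + 1 by omega),
        qbinom_eq_zero (p := q ^ 2) (show j + 1 < l + 1 by omega)]
    · rw [qbinom_pascal hq hj, Nat.add_sub_add_right, ← add_assoc, Nat.add_sub_add_right]
      module

/-- The 3d R matrix is the transition matrix between the two PBW bases in rank two. -/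
theorem qpow_mul_qpow_mul_qpow (hq : IsGeneric q) (h : IsRootTriple q x y z) {i j k N : ℕ}
    (hij : i + j < N) (hjk : j + k < N) :
    qpow q y k * qpow q (x * y - q • z) j * qpow q x i =
      ∑ a ∈ range N, ∑ b ∈ range N, ∑ c ∈ range N,
        R3 q a b c i j k • (qpow q x a * qpow q z b * qpow q y c) := by
  have h0 := hq.ne_zero
  let T : ℕ → ℕ → A := fun l μ =>
    if l + μ ≤ i + j ∧ l + μ ≤ j + k then
      ((-1 : K) ^ l *
        q ^ ((i : ℤ) * (((j + k - (l + μ) : ℕ) : ℤ) - (j : ℤ)) + ((k : ℤ) + 1) * (l : ℤ)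
            + (((l + μ : ℕ) : ℤ) - (l : ℤ)) * (((l + μ : ℕ) : ℤ) - (l : ℤ) - (k : ℤ))) *
        (poch (q ^ 2) (q ^ 2) (j + k - (l + μ) + μ) / poch (q ^ 2) (q ^ 2) (j + k - (l + μ))) *
        qbinom (q ^ 2) i μ * qbinom (q ^ 2) j l) •
      (qpow q x (i + j - (l + μ)) * qpow q z (l + μ) * qpow q y (j + k - (l + μ))) else 0
  trans ∑ l ∈ range N, ∑ μ ∈ range (N - l), T l μ
  · rw [h.qpow_mul_qpow_swap hq k j N (by omega), sum_mul]
    refine sum_congr rfl fun l _ => ?_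
    rcases lt_or_ge j l with hl | hl
    · simp [T, qbinom_eq_zero hl]
    rw [smul_mul_assoc, mul_assoc (qpow q x _ * qpow q z _),
      h.qpow_mul_qpow hq _ i (N - l) (by omega), mul_sum, smul_sum]
    refine sum_congr rfl fun μ _ => ?_
    rcases lt_or_ge i μ with hμ | hμ
    · simp [T, qbinom_eq_zero hμ]
    rcases lt_or_ge (k + j - l) μ with hm | hm
    · rw [qbinom_eq_zero hm]
      simp only [T]
      rw [if_neg (by omega)]
      simp
    simp only [T]
    rw [if_pos (by omega)]
    obtain ⟨d, rfl⟩ := Nat.exists_eq_add_of_le hl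
    obtain ⟨e, rfl⟩ := Nat.exists_eq_add_of_le hμ
    obtain ⟨f, hf⟩ := Nat.exists_eq_add_of_le hm
    have hP := hq.poch_ne_zero f
    have hP' := hq.poch_ne_zero μ
    rw [hf, show l + d - l = d by omega, show μ + e - μ = e by omega,
      show μ + f - μ = f by omega, show l + d + k - (l + μ) = f by omega,
      show μ + e + (l + d) - (l + μ) = d + e by omega, qpow_add, qpow_add]
    have hx : qpow q x d * qpow q z l * (qpow q x e * qpow q z μ * qpow q y f) =
        q⁻¹ ^ (l * e) • (qpow q x d * qpow q x e * qpow q z l * qpow q z μ * qpow q y f) := by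
      rw [show qpow q x d * qpow q z l * (qpow q x e * qpow q z μ * qpow q y f) =
        qpow q x d * (qpow q z l * qpow q x e) * qpow q z μ * qpow q y f by
          simp only [mul_assoc], qpow_mul_qpow_of_qcomm h.zx]
      simp only [smul_mul_assoc, mul_smul_comm, mul_assoc]
    have hb : qbinom (q ^ 2) (μ + f) μ = poch (q ^ 2) (q ^ 2) (μ + f) /
        (poch (q ^ 2) (q ^ 2) μ * poch (q ^ 2) (q ^ 2) f) := by
      rw [qbinom, if_pos (by omega), Nat.add_sub_cancel_left]
    rw [mul_smul_comm, hx, hb, add_comm f μ]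
    simp only [smul_mul_assoc, mul_smul_comm, mul_assoc, smul_smul, inv_pow]
    congr 1
    rw [show ((μ + e : ℕ) : ℤ) * ((f : ℤ) - ((l + d : ℕ) : ℤ)) + ((k : ℤ) + 1) * (l : ℤ) +
        (((l + μ : ℕ) : ℤ) - (l : ℤ)) * (((l + μ : ℕ) : ℤ) - (l : ℤ) - (k : ℤ)) =
        (((k + 1) * l + e * f : ℕ) : ℤ) - ((l * e + d * e + l * μ : ℕ) : ℤ) by
      have : (k : ℤ) = μ + f - d := by omega
      push_cast
      rw [this]
      ring, zpow_sub₀ h0, zpow_natCast, zpow_natCast]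
    field_simp
    ring
  · rw [← sum_range_diag_flip, sum_comm]
    refine sum_congr rfl fun b _ => ?_
    symm
    by_cases hb : b ≤ i + j ∧ b ≤ j + k
    · rw [Finset.sum_eq_single (i + j - b), Finset.sum_eq_single (j + k - b), R3,
        if_pos (by omega), sum_smul]
      · refine sum_congr rfl fun l hl => ?_
        have : l + (b - l) = b := by have := mem_range.1 hl; omega
        simp only [T, this, if_pos hb]
      · intro c _ hc
        rw [R3, if_neg (by omega), zero_smul]
      · intro hc
        simp only [mem_range] at hc
        omega
      · intro a _ ha
        refine Finset.sum_eq_zero fun c _ => ?_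
        rw [R3, if_neg (by omega), zero_smul]
      · intro ha
        simp only [mem_range] at ha
        omega
    · trans (0 : A)
      · refine Finset.sum_eq_zero fun a _ => Finset.sum_eq_zero fun c _ => ?_
        rw [R3, if_neg (by omega), zero_smul]
      · refine (Finset.sum_eq_zero fun l hl => ?_).symm
        have : l + (b - l) = b := by have := mem_range.1 hl; omega
        simp only [T, this, if_neg hb]

end IsRootTriple

/-- Root vectors of type `A₃` attached to simple root vectors `e₁, e₂, e₃`: `a`, `b`, `c` belong
to the roots `α₁ + α₂`, `α₂ + α₃` and `α₁ + α₂ + α₃`. -/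
structure IsRootSystem (q : K) (e₁ e₂ e₃ a b c : A) : Prop where
  ne_zero : IsGeneric q
  h12 : IsRootTriple q e₁ e₂ a
  h23 : IsRootTriple q e₂ e₃ b
  comm : e₁ * e₃ = e₃ * e₁
  e3_mul_a : e₃ * a = q • (a * e₃) + (1 - q ^ 2) • c

namespace IsRootSystem

variable {e₁ e₂ e₃ a b c : A}

theorem b_mul_e1 (h : IsRootSystem q e₁ e₂ e₃ a b c) :
    b * e₁ = q • (e₁ * b) + (1 - q ^ 2) • c := by
  have h1 := h.ne_zero.one_sub_sq_ne_zero
  let w := (1 - q ^ 2)⁻¹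
  linear_combination (norm := skip) (-w) • (h.h23.mul_eq * e₁) + (q * w) • (e₁ * h.h23.mul_eq) +
    w • (e₃ * h.h12.mul_eq) - (q * w) • (h.h12.mul_eq * e₃) + h.e3_mul_a +
    (w * q) • (e₂ * h.comm) - (w * q) • (h.comm * e₂)
  simp only [mul_add, add_mul, smul_mul_assoc, mul_smul_comm, mul_assoc, w]
  match_scalars <;> field_simp <;> ring

theorem c_mul_e1 (h : IsRootSystem q e₁ e₂ e₃ a b c) : c * e₁ = q⁻¹ • (e₁ * c) := by
  have h0 := h.ne_zero.ne_zero
  have h1 := h.ne_zero.one_sub_sq_ne_zero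
  let w := (1 - q ^ 2)⁻¹
  linear_combination (norm := skip) (-w) • (h.e3_mul_a * e₁) + (w * q⁻¹) • (e₁ * h.e3_mul_a) +
    w • (e₃ * h.h12.zx) - (w * q) • (h.h12.zx * e₃) + (w * q) • (a * h.comm) -
    (w * q⁻¹) • (h.comm * a)
  simp only [mul_add, add_mul, smul_mul_assoc, mul_smul_comm, mul_assoc, w]
  match_scalars <;> field_simp <;> ring

theorem e3_mul_c (h : IsRootSystem q e₁ e₂ e₃ a b c) : e₃ * c = q⁻¹ • (c * e₃) := by
  have h0 := h.ne_zero.ne_zero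
  have h1 := h.ne_zero.one_sub_sq_ne_zero
  let w := (1 - q ^ 2)⁻¹
  linear_combination (norm := skip) (-w) • (e₃ * h.b_mul_e1) + (w * q⁻¹) • (h.b_mul_e1 * e₃) +
    w • (h.h23.yz * e₁) - (w * q) • (e₁ * h.h23.yz) + (w * q) • (h.comm * b) -
    (w * q⁻¹) • (b * h.comm)
  simp only [mul_add, add_mul, smul_mul_assoc, mul_smul_comm, mul_assoc, w]
  match_scalars <;> field_simp <;> ring

theorem a_mul_e2_e3 (h : IsRootSystem q e₁ e₂ e₃ a b c) :
    a * (e₂ * e₃) - e₂ * e₃ * a = -(1 - q ^ 2) • (e₂ * c) := by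
  have h0 := h.ne_zero.ne_zero
  linear_combination (norm := skip) -(e₂ * h.e3_mul_a) - q • (h.h12.yz * e₃)
  simp only [mul_add, smul_mul_assoc, mul_smul_comm, mul_assoc]
  match_scalars <;> field_simp <;> ring

theorem a_mul_b (h : IsRootSystem q e₁ e₂ e₃ a b c) :
    a * b - b * a = q • (e₂ * c) - q⁻¹ • (c * e₂) := by
  have h0 := h.ne_zero.ne_zero
  have h1 := h.ne_zero.one_sub_sq_ne_zero
  let w := (1 - q ^ 2)⁻¹
  have h2 : a * (e₃ * e₂) - e₃ * e₂ * a = -((1 - q ^ 2) * q⁻¹) • (c * e₂) := by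
    linear_combination (norm := skip) (-q⁻¹) • (h.e3_mul_a * e₂) - e₃ * h.h12.yz
    simp only [add_mul, smul_mul_assoc, mul_smul_comm, mul_assoc]
    match_scalars <;> field_simp <;> ring
  linear_combination (norm := skip) w • h2 - (w * q) • h.a_mul_e2_e3 + w • (h.h23.mul_eq * a) -
    w • (a * h.h23.mul_eq)
  simp only [mul_add, add_mul, smul_mul_assoc, mul_smul_comm, mul_assoc, w]
  match_scalars <;> field_simp <;> ring

theorem e1_e2_mul_b (h : IsRootSystem q e₁ e₂ e₃ a b c) :
    e₁ * e₂ * b - b * (e₁ * e₂) = -(1 - q ^ 2) • (c * e₂) := by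
  have h0 := h.ne_zero.ne_zero
  linear_combination (norm := skip) -(h.b_mul_e1 * e₂) - q • (e₁ * h.h23.zx)
  simp only [add_mul, smul_mul_assoc, mul_smul_comm, mul_assoc]
  match_scalars <;> field_simp <;> ring

theorem a_mul_b' (h : IsRootSystem q e₁ e₂ e₃ a b c) :
    a * b - b * a = q • (c * e₂) - q⁻¹ • (e₂ * c) := by
  have h0 := h.ne_zero.ne_zero
  have h1 := h.ne_zero.one_sub_sq_ne_zero
  let w := (1 - q ^ 2)⁻¹
  have h2 : e₂ * e₁ * b - b * (e₂ * e₁) = -((1 - q ^ 2) * q⁻¹) • (e₂ * c) := by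
    linear_combination (norm := skip) (-q⁻¹) • (e₂ * h.b_mul_e1) - h.h23.zx * e₁
    simp only [mul_add, smul_mul_assoc, mul_smul_comm, mul_assoc]
    match_scalars <;> field_simp <;> ring
  linear_combination (norm := skip) w • h2 - (w * q) • h.e1_e2_mul_b + w • (b * h.h12.mul_eq) -
    w • (h.h12.mul_eq * b)
  simp only [mul_add, add_mul, smul_mul_assoc, mul_smul_comm, mul_assoc, w]
  match_scalars <;> field_simp <;> ring

theorem e2_mul_c (h : IsRootSystem q e₁ e₂ e₃ a b c) : e₂ * c = c * e₂ := by
  have h0 := h.ne_zero.ne_zero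
  have h2 : 1 + q ^ 2 ≠ 0 := by
    intro h2
    apply h.ne_zero.one_sub_ne_zero 1
    linear_combination (1 - q ^ 2) * h2
  linear_combination (norm := skip) (q * (1 + q ^ 2)⁻¹) • h.a_mul_b' -
    (q * (1 + q ^ 2)⁻¹) • h.a_mul_b
  match_scalars <;> field_simp <;> ring

theorem a'_mul_b (h : IsRootSystem q e₁ e₂ e₃ a b c) :
    (e₁ * e₂ - q • a) * b = b * (e₁ * e₂ - q • a) := by
  have h0 := h.ne_zero.ne_zero
  linear_combination (norm := skip) h.e1_e2_mul_b - q • h.a_mul_b - q ^ 2 • h.e2_mul_c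
  simp only [mul_sub, sub_mul, smul_mul_assoc, mul_smul_comm, mul_assoc]
  match_scalars <;> field_simp <;> ring

theorem a_mul_b'' (h : IsRootSystem q e₁ e₂ e₃ a b c) :
    a * (e₂ * e₃ - q • b) = (e₂ * e₃ - q • b) * a := by
  have h0 := h.ne_zero.ne_zero
  linear_combination (norm := skip) h.a_mul_e2_e3 - q • h.a_mul_b - h.e2_mul_c
  simp only [mul_sub, sub_mul, smul_mul_assoc, mul_smul_comm, mul_assoc]
  match_scalars <;> field_simp <;> ring

theorem triple_e1_b (h : IsRootSystem q e₁ e₂ e₃ a b c) : IsRootTriple q e₁ b c := by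
  have h0 := h.ne_zero.ne_zero
  have h1 := h.ne_zero.one_sub_sq_ne_zero
  let w := (1 - q ^ 2)⁻¹
  refine ⟨h.b_mul_e1, h.c_mul_e1, ?_⟩
  linear_combination (norm := skip) (-w) • (h.h23.mul_eq * c) + (w * q⁻¹) • (c * h.h23.mul_eq) +
    w • (e₃ * h.e2_mul_c) + w • (h.e3_mul_c * e₂) - (w * q) • (e₂ * h.e3_mul_c) -
    w • (h.e2_mul_c * e₃)
  simp only [mul_add, add_mul, smul_mul_assoc, mul_smul_comm, mul_assoc, w]
  match_scalars <;> field_simp <;> ring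

theorem triple_a_e3 (h : IsRootSystem q e₁ e₂ e₃ a b c) : IsRootTriple q a e₃ c := by
  have h0 := h.ne_zero.ne_zero
  have h1 := h.ne_zero.one_sub_sq_ne_zero
  let w := (1 - q ^ 2)⁻¹
  refine ⟨h.e3_mul_a, ?_, h.e3_mul_c⟩
  linear_combination (norm := skip) (-w) • (c * h.h12.mul_eq) + (w * q⁻¹) • (h.h12.mul_eq * c) -
    w • (h.e2_mul_c * e₁) + w • (e₂ * h.c_mul_e1) - (w * q) • (h.c_mul_e1 * e₂) +
    w • (e₁ * h.e2_mul_c)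
  simp only [mul_add, add_mul, smul_mul_assoc, mul_smul_comm, mul_assoc, w]
  match_scalars <;> field_simp <;> ring

theorem triple_a'_e3 (h : IsRootSystem q e₁ e₂ e₃ a b c) :
    IsRootTriple q (e₁ * e₂ - q • a) e₃ (e₁ * b - q • c) := by
  have h0 := h.ne_zero.ne_zero
  have h1 := h.ne_zero.one_sub_sq_ne_zero
  let w := (1 - q ^ 2)⁻¹
  refine ⟨?_, ?_, ?_⟩
  · linear_combination (norm := skip) e₁ * h.h23.mul_eq - q • h.e3_mul_a - h.comm * e₂
    simp only [mul_add, mul_sub, sub_mul, smul_mul_assoc, mul_smul_comm, mul_assoc]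
    match_scalars <;> field_simp <;> ring
  · have hS := (h.triple_e1_b.swap h.ne_zero).mul_eq
    have hY := (h.h12.swap h.ne_zero).yz
    have hX := h.a'_mul_b
    generalize e₁ * e₂ - q • a = a' at *
    generalize e₁ * b - q • c = c' at *
    linear_combination (norm := skip) (-w) • (hS * a') + (w * q⁻¹) • (a' * hS) +
      w • (hY * b) - w • (e₁ * hX) - (w * q) • (b * hY) + w • (hX * e₁)
    simp only [mul_add, add_mul, smul_mul_assoc, mul_smul_comm, mul_assoc, w]
    match_scalars <;> field_simp <;> ring
  · linear_combination (norm := skip) e₁ * h.h23.yz - q • h.e3_mul_c - h.comm * b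
    simp only [mul_sub, sub_mul, smul_mul_assoc, mul_smul_comm, mul_assoc]
    match_scalars <;> field_simp <;> ring

theorem triple_e1_b' (h : IsRootSystem q e₁ e₂ e₃ a b c) :
    IsRootTriple q e₁ (e₂ * e₃ - q • b) (a * e₃ - q • c) := by
  have h0 := h.ne_zero.ne_zero
  have h1 := h.ne_zero.one_sub_sq_ne_zero
  let w := (1 - q ^ 2)⁻¹
  refine ⟨?_, ?_, ?_⟩
  · linear_combination (norm := skip) h.h12.mul_eq * e₃ - q • h.b_mul_e1 - e₂ * h.comm
    simp only [add_mul, mul_sub, sub_mul, smul_mul_assoc, mul_smul_comm, mul_assoc]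
    match_scalars <;> field_simp <;> ring
  · linear_combination (norm := skip) h.h12.zx * e₃ - q • h.c_mul_e1 - a * h.comm
    simp only [mul_sub, sub_mul, smul_mul_assoc, mul_smul_comm, mul_assoc]
    match_scalars <;> field_simp <;> ring
  · have hS := (h.triple_a_e3.swap h.ne_zero).mul_eq
    have hY := (h.h23.swap h.ne_zero).zx
    have hX := h.a_mul_b''
    generalize e₂ * e₃ - q • b = b' at *
    generalize a * e₃ - q • c = d at *
    linear_combination (norm := skip) (-w) • (b' * hS) + (w * q⁻¹) • (hS * b') +
      w • (a * hY) - w • (hX * e₃) - (w * q) • (hY * a) + w • (e₃ * hX)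
    simp only [mul_add, add_mul, smul_mul_assoc, mul_smul_comm, mul_assoc, w]
    match_scalars <;> field_simp <;> ring

theorem e2_mul_c'' (h : IsRootSystem q e₁ e₂ e₃ a b c) :
    e₂ * ((e₁ * e₂ - q • a) * e₃ - q • (e₁ * b - q • c)) =
      ((e₁ * e₂ - q • a) * e₃ - q • (e₁ * b - q • c)) * e₂ := by
  have h0 := h.ne_zero.ne_zero
  have h1 := h.ne_zero.one_sub_sq_ne_zero
  let w := (1 - q ^ 2)⁻¹
  have hS := (h.triple_a'_e3.swap h.ne_zero).mul_eq
  have hY := (h.h12.swap h.ne_zero).zx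
  have hX := h.a'_mul_b
  have hb := h.h23.mul_eq
  generalize (e₁ * e₂ - q • a) * e₃ - q • (e₁ * b - q • c) = c'' at *
  generalize e₁ * e₂ - q • a = a' at *
  linear_combination (norm := skip) (-w) • (e₂ * hS) + w • (hS * e₂) - (w * q) • (hY * e₃) +
    (w * q) • (e₃ * hY) - w • (a' * hb) + w • (hb * a') - hX
  simp only [mul_add, add_mul, smul_mul_assoc, mul_smul_comm, mul_assoc, w]
  match_scalars <;> field_simp <;> ring

theorem c''_eq (e₁ e₂ e₃ a b c : A) :
    (e₁ * e₂ - q • a) * e₃ - q • (e₁ * b - q • c) =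
      e₁ * (e₂ * e₃ - q • b) - q • (a * e₃ - q • c) := by
  simp only [mul_sub, sub_mul, smul_mul_assoc, mul_smul_comm, mul_assoc]
  module
end IsRootSystem

theorem R3_conservation {a b c i j k : ℕ} (h : R3 q a b c i j k ≠ 0) :
    a + b = i + j ∧ b + c = j + k := by
  by_contra hc
  exact h (if_neg hc)

/-- The change of PBW basis, applied inside a word and evaluated by a linear functional. -/
theorem IsRootTriple.map_word {x y z w : A} (hq : IsGeneric q) (h : IsRootTriple q x y z)
    (φ : A →ₗ[K] K) (u v : A) {i j k N : ℕ} (hij : i + j < N) (hjk : j + k < N)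
    {f : ℕ → ℕ → ℕ → K}
    (hw : w = u * (qpow q y k * qpow q (x * y - q • z) j * qpow q x i) * v)
    (hf : ∀ a b c, a + b = i + j → b + c = j + k →
      φ (u * (qpow q x a * qpow q z b * qpow q y c) * v) = f a b c) :
    φ w = ∑ a ∈ range N, ∑ b ∈ range N, ∑ c ∈ range N, R3 q a b c i j k * f a b c := by
  rw [hw, h.qpow_mul_qpow_mul_qpow hq hij hjk]
  simp only [mul_sum, sum_mul, map_sum, mul_smul_comm, smul_mul_assoc, map_smul, smul_eq_mul]
  refine sum_congr rfl fun a _ => sum_congr rfl fun b _ => sum_congr rfl fun c _ => ?_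
  by_cases hR : R3 q a b c i j k = 0
  · simp [hR]
  · rw [hf a b c (R3_conservation hR).1 (R3_conservation hR).2]

/-- `φ` is the coordinate functional of a monomial in the PBW basis
`e₁ ^ i₁ * a ^ i₂ * e₂ ^ i₄ * c ^ i₃ * b ^ i₅ * e₃ ^ i₆`. -/
def IsCoordinate (q : K) (e₁ e₂ e₃ a b c : A) (φ : A →ₗ[K] K) (a₁ a₂ a₃ a₄ a₅ a₆ : ℕ) : Prop :=
  ∀ i₁ i₂ i₃ i₄ i₅ i₆ : ℕ,
    φ (qpow q e₁ i₁ * qpow q a i₂ * qpow q e₂ i₄ * qpow q c i₃ * qpow q b i₅ * qpow q e₃ i₆) =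
      if (a₁ = i₁ ∧ a₂ = i₂ ∧ a₄ = i₄) ∧ a₃ = i₃ ∧ a₅ = i₅ ∧ a₆ = i₆ then 1 else 0

namespace IsRootSystem

section Left

variable {φ : A →ₗ[K] K} {a₁ a₂ a₃ a₄ a₅ a₆ N : ℕ}

theorem map_left₁₂₄ (h : IsRootSystem q e₁ e₂ e₃ a b c)
    (hφ : IsCoordinate q e₁ e₂ e₃ a b c φ a₁ a₂ a₃ a₄ a₅ a₆) (haN : a₁ + a₂ + a₄ < N)
    {i₁ i₂ i₃ i₄ i₅ i₆ : ℕ} (hN : i₁ + i₂ + i₃ + i₄ + i₅ + i₆ < N) :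
    φ (qpow q e₂ i₄ * qpow q (e₁ * e₂ - q • a) i₂ * qpow q e₁ i₁ * qpow q c i₃ * qpow q b i₅ *
        qpow q e₃ i₆) =
      if a₃ = i₃ ∧ a₅ = i₅ ∧ a₆ = i₆ then R3 q a₁ a₂ a₄ i₁ i₂ i₄ else 0 := by
  rw [h.h12.map_word h.ne_zero φ 1 (qpow q c i₃ * qpow q b i₅ * qpow q e₃ i₆)
    (i := i₁) (j := i₂) (k := i₄) (N := N)
    (f := fun x y z => if (a₁ = x ∧ a₂ = y ∧ a₄ = z) ∧ a₃ = i₃ ∧ a₅ = i₅ ∧ a₆ = i₆ then 1 else 0)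
    (by omega) (by omega) (by simp only [one_mul, mul_assoc])
    fun x y z _ _ => by simpa only [one_mul, mul_assoc] using hφ x y i₃ z i₅ i₆]
  have : a₁ < N ∧ a₂ < N ∧ a₄ < N := by omega
  by_cases hi : a₃ = i₃ ∧ a₅ = i₅ ∧ a₆ = i₆
  · simp [hi, ite_and, this]
  · simp [hi]

theorem map_left₁₃₅ (h : IsRootSystem q e₁ e₂ e₃ a b c)
    (hφ : IsCoordinate q e₁ e₂ e₃ a b c φ a₁ a₂ a₃ a₄ a₅ a₆) (haN : a₁ + a₂ + a₃ + a₄ + a₅ < N)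
    {i₁ i₂ i₃ i₄ i₅ i₆ : ℕ} (hN : 2 * (i₁ + i₂ + i₃ + i₄ + i₅ + i₆) < N) :
    φ (qpow q e₂ i₄ * qpow q (e₁ * e₂ - q • a) i₂ * qpow q b i₅ * qpow q (e₁ * b - q • c) i₃ *
        qpow q e₁ i₁ * qpow q e₃ i₆) =
      if a₆ = i₆ then ∑ x ∈ range N, R3 q x a₃ a₅ i₁ i₃ i₅ * R3 q a₁ a₂ a₄ x i₂ i₄ else 0 := by
  rw [h.triple_e1_b.map_word h.ne_zero φ (qpow q e₂ i₄ * qpow q (e₁ * e₂ - q • a) i₂)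
    (qpow q e₃ i₆) (i := i₁) (j := i₃) (k := i₅) (N := N)
    (f := fun x y z => if a₃ = y ∧ a₅ = z ∧ a₆ = i₆ then R3 q a₁ a₂ a₄ x i₂ i₄ else 0)
    (by omega) (by omega) (by simp only [mul_assoc])
    fun x y z _ _ => by
      simpa only [mul_assoc] using h.map_left₁₂₄ hφ (i₁ := x) (i₂ := i₂) (i₃ := y) (i₄ := i₄)
        (i₅ := z) (i₆ := i₆) (N := N) (by omega) (by omega)]
  have : a₃ < N ∧ a₅ < N := by omega
  by_cases hi : a₆ = i₆
  · simp [hi, ite_and, this]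
  · simp [hi]

theorem map_left₂₃₆ (h : IsRootSystem q e₁ e₂ e₃ a b c)
    (hφ : IsCoordinate q e₁ e₂ e₃ a b c φ a₁ a₂ a₃ a₄ a₅ a₆)
    (haN : a₁ + a₂ + a₃ + a₄ + a₅ + a₆ < N)
    {i₁ i₂ i₃ i₄ i₅ i₆ : ℕ} (hN : 4 * (i₁ + i₂ + i₃ + i₄ + i₅ + i₆) < N) :
    φ (qpow q e₂ i₄ * qpow q b i₅ * qpow q e₃ i₆ *
        qpow q ((e₁ * e₂ - q • a) * e₃ - q • (e₁ * b - q • c)) i₃ *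
        qpow q (e₁ * e₂ - q • a) i₂ * qpow q e₁ i₁) =
      ∑ x ∈ range N, ∑ y ∈ range N, R3 q x y a₆ i₂ i₃ i₆ *
        ∑ z ∈ range N, R3 q z a₃ a₅ i₁ y i₅ * R3 q a₁ a₂ a₄ z x i₄ := by
  rw [h.triple_a'_e3.map_word h.ne_zero φ (qpow q e₂ i₄ * qpow q b i₅)
    (qpow q e₁ i₁) (i := i₂) (j := i₃) (k := i₆) (N := N)
    (f := fun x y z => if a₆ = z then
      ∑ w ∈ range N, R3 q w a₃ a₅ i₁ y i₅ * R3 q a₁ a₂ a₄ w x i₄ else 0)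
    (by omega) (by omega) (by simp only [mul_assoc])
    fun x y z _ _ => by
      rw [← h.map_left₁₃₅ hφ (i₁ := i₁) (i₂ := x) (i₃ := y) (i₄ := i₄)
        (i₅ := i₅) (i₆ := z) (N := N) (by omega) (by omega)]
      congr 1
      simp only [mul_assoc]
      rw [qpow_commute (q := q) h.comm.symm z i₁, ← mul_assoc (qpow q b i₅),
        ← qpow_commute (q := q) h.a'_mul_b x i₅]
      simp only [mul_assoc]]
  have : a₆ < N := by omega
  simp [this]

theorem map_left (h : IsRootSystem q e₁ e₂ e₃ a b c)
    (hφ : IsCoordinate q e₁ e₂ e₃ a b c φ a₁ a₂ a₃ a₄ a₅ a₆)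
    (haN : a₁ + a₂ + a₃ + a₄ + a₅ + a₆ < N)
    {i₁ i₂ i₃ i₄ i₅ i₆ : ℕ} (hN : 8 * (i₁ + i₂ + i₃ + i₄ + i₅ + i₆) < N) :
    φ (qpow q e₃ i₆ * qpow q (e₂ * e₃ - q • b) i₅ * qpow q e₂ i₄ *
        qpow q ((e₁ * e₂ - q • a) * e₃ - q • (e₁ * b - q • c)) i₃ *
        qpow q (e₁ * e₂ - q • a) i₂ * qpow q e₁ i₁) =
      ∑ j₄ ∈ range N, ∑ j₅ ∈ range N, ∑ j₆ ∈ range N, R3 q j₄ j₅ j₆ i₄ i₅ i₆ *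
        ∑ j₂ ∈ range N, ∑ j₃ ∈ range N, R3 q j₂ j₃ a₆ i₂ i₃ j₆ *
          ∑ j₁ ∈ range N, R3 q j₁ a₃ a₅ i₁ j₃ j₅ * R3 q a₁ a₂ a₄ j₁ j₂ j₄ :=
  h.h23.map_word h.ne_zero φ 1
    (qpow q ((e₁ * e₂ - q • a) * e₃ - q • (e₁ * b - q • c)) i₃ *
        qpow q (e₁ * e₂ - q • a) i₂ * qpow q e₁ i₁)
    (by omega) (by omega) (by simp only [one_mul, mul_assoc])
    fun x y z _ _ => by
      simpa only [one_mul, mul_assoc] using h.map_left₂₃₆ hφ (i₁ := i₁) (i₂ := i₂) (i₃ := i₃)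
        (i₄ := x) (i₅ := y) (i₆ := z) (N := N) (by omega) (by omega)

end Left

section Right

variable {φ : A →ₗ[K] K} {a₁ a₂ a₃ a₄ a₅ a₆ N : ℕ}

theorem map_right₄₅₆ (h : IsRootSystem q e₁ e₂ e₃ a b c)
    (hφ : IsCoordinate q e₁ e₂ e₃ a b c φ a₁ a₂ a₃ a₄ a₅ a₆) (haN : a₄ + a₅ + a₆ < N)
    {i₁ i₂ i₃ i₄ i₅ i₆ : ℕ} (hN : i₁ + i₂ + i₃ + i₄ + i₅ + i₆ < N) :
    φ (qpow q e₁ i₁ * qpow q a i₂ * qpow q c i₃ * qpow q e₃ i₆ * qpow q (e₂ * e₃ - q • b) i₅ *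
        qpow q e₂ i₄) =
      if a₁ = i₁ ∧ a₂ = i₂ ∧ a₃ = i₃ then R3 q a₄ a₅ a₆ i₄ i₅ i₆ else 0 := by
  rw [h.h23.map_word h.ne_zero φ (qpow q e₁ i₁ * qpow q a i₂ * qpow q c i₃) 1
    (i := i₄) (j := i₅) (k := i₆) (N := N)
    (f := fun x y z => if (a₁ = i₁ ∧ a₂ = i₂ ∧ a₄ = x) ∧ a₃ = i₃ ∧ a₅ = y ∧ a₆ = z then 1 else 0)
    (by omega) (by omega) (by simp only [mul_one, mul_assoc])
    fun x y z _ _ => by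
      rw [← hφ]
      congr 1
      simp only [mul_one, mul_assoc]
      rw [← mul_assoc (qpow q c i₃), ← qpow_commute (q := q) h.e2_mul_c x i₃]
      simp only [mul_assoc]]
  have : a₄ < N ∧ a₅ < N ∧ a₆ < N := by omega
  by_cases hi : a₁ = i₁ ∧ a₂ = i₂ ∧ a₃ = i₃
  · simp [hi, ite_and, this]
  · rw [if_neg hi]
    refine sum_eq_zero fun x _ => sum_eq_zero fun y _ => sum_eq_zero fun z _ => ?_
    rw [if_neg (by tauto), mul_zero]

theorem map_right₂₃₆ (h : IsRootSystem q e₁ e₂ e₃ a b c)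
    (hφ : IsCoordinate q e₁ e₂ e₃ a b c φ a₁ a₂ a₃ a₄ a₅ a₆) (haN : a₂ + a₃ + a₄ + a₅ + a₆ < N)
    {i₁ i₂ i₃ i₄ i₅ i₆ : ℕ} (hN : 2 * (i₁ + i₂ + i₃ + i₄ + i₅ + i₆) < N) :
    φ (qpow q e₁ i₁ * qpow q e₃ i₆ * qpow q (a * e₃ - q • c) i₃ * qpow q a i₂ *
        qpow q (e₂ * e₃ - q • b) i₅ * qpow q e₂ i₄) =
      if a₁ = i₁ then ∑ z ∈ range N, R3 q a₂ a₃ z i₂ i₃ i₆ * R3 q a₄ a₅ a₆ i₄ i₅ z else 0 := by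
  rw [h.triple_a_e3.map_word h.ne_zero φ (qpow q e₁ i₁)
    (qpow q (e₂ * e₃ - q • b) i₅ * qpow q e₂ i₄) (i := i₂) (j := i₃) (k := i₆) (N := N)
    (f := fun x y z => if a₁ = i₁ ∧ a₂ = x ∧ a₃ = y then R3 q a₄ a₅ a₆ i₄ i₅ z else 0)
    (by omega) (by omega) (by simp only [mul_assoc])
    fun x y z _ _ => by
      simpa only [mul_assoc] using h.map_right₄₅₆ hφ (i₁ := i₁) (i₂ := x) (i₃ := y) (i₄ := i₄)
        (i₅ := i₅) (i₆ := z) (N := N) (by omega) (by omega)]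
  have : a₂ < N ∧ a₃ < N := by omega
  by_cases hi : a₁ = i₁
  · simp [hi, ite_and, this]
  · simp [hi]

theorem map_right₁₃₅ (h : IsRootSystem q e₁ e₂ e₃ a b c)
    (hφ : IsCoordinate q e₁ e₂ e₃ a b c φ a₁ a₂ a₃ a₄ a₅ a₆)
    (haN : a₁ + a₂ + a₃ + a₄ + a₅ + a₆ < N)
    {i₁ i₂ i₃ i₄ i₅ i₆ : ℕ} (hN : 4 * (i₁ + i₂ + i₃ + i₄ + i₅ + i₆) < N) :
    φ (qpow q e₃ i₆ * qpow q (e₂ * e₃ - q • b) i₅ *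
        qpow q ((e₁ * e₂ - q • a) * e₃ - q • (e₁ * b - q • c)) i₃ *
        qpow q e₁ i₁ * qpow q a i₂ * qpow q e₂ i₄) =
      ∑ y ∈ range N, ∑ z ∈ range N, R3 q a₁ y z i₁ i₃ i₅ *
        ∑ w ∈ range N, R3 q a₂ a₃ w i₂ y i₆ * R3 q a₄ a₅ a₆ i₄ z w := by
  rw [c''_eq, h.triple_e1_b'.map_word h.ne_zero φ (qpow q e₃ i₆)
    (qpow q a i₂ * qpow q e₂ i₄) (i := i₁) (j := i₃) (k := i₅) (N := N)
    (f := fun x y z => if a₁ = x then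
      ∑ w ∈ range N, R3 q a₂ a₃ w i₂ y i₆ * R3 q a₄ a₅ a₆ i₄ z w else 0)
    (by omega) (by omega) (by simp only [mul_assoc])
    fun x y z _ _ => by
      rw [← h.map_right₂₃₆ hφ (i₁ := x) (i₂ := i₂) (i₃ := y) (i₄ := i₄)
        (i₅ := z) (i₆ := i₆) (N := N) (by omega) (by omega)]
      congr 1
      rw [← mul_assoc (qpow q e₃ i₆), ← mul_assoc (qpow q e₃ i₆),
        ← qpow_commute (q := q) h.comm x i₆]
      simp only [mul_assoc]
      rw [← mul_assoc (qpow q a i₂), qpow_commute (q := q) h.a_mul_b'' i₂ z]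
      simp only [mul_assoc]]
  have : a₁ < N := by omega
  simp [this]

theorem map_right (h : IsRootSystem q e₁ e₂ e₃ a b c)
    (hφ : IsCoordinate q e₁ e₂ e₃ a b c φ a₁ a₂ a₃ a₄ a₅ a₆)
    (haN : a₁ + a₂ + a₃ + a₄ + a₅ + a₆ < N)
    {i₁ i₂ i₃ i₄ i₅ i₆ : ℕ} (hN : 8 * (i₁ + i₂ + i₃ + i₄ + i₅ + i₆) < N) :
    φ (qpow q e₃ i₆ * qpow q (e₂ * e₃ - q • b) i₅ * qpow q e₂ i₄ *
        qpow q ((e₁ * e₂ - q • a) * e₃ - q • (e₁ * b - q • c)) i₃ *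
        qpow q (e₁ * e₂ - q • a) i₂ * qpow q e₁ i₁) =
      ∑ j₁ ∈ range N, ∑ j₂ ∈ range N, ∑ j₄ ∈ range N, R3 q j₁ j₂ j₄ i₁ i₂ i₄ *
        ∑ j₃ ∈ range N, ∑ j₅ ∈ range N, R3 q a₁ j₃ j₅ j₁ i₃ i₅ *
          ∑ j₆ ∈ range N, R3 q a₂ a₃ j₆ j₂ j₃ i₆ * R3 q a₄ a₅ a₆ j₄ j₅ j₆ :=
  h.h12.map_word h.ne_zero φ (qpow q e₃ i₆ * qpow q (e₂ * e₃ - q • b) i₅ *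
        qpow q ((e₁ * e₂ - q • a) * e₃ - q • (e₁ * b - q • c)) i₃) 1
    (by omega) (by omega)
    (by
      simp only [mul_one, mul_assoc]
      rw [← mul_assoc (qpow q e₂ i₄), qpow_commute (q := q) h.e2_mul_c'' i₄ i₃]
      simp only [mul_assoc])
    fun x y z _ _ => by
      simpa only [mul_one, mul_assoc] using h.map_right₁₃₅ hφ (i₁ := x) (i₂ := y) (i₃ := i₃)
        (i₄ := z) (i₅ := i₅) (i₆ := i₆) (N := N) (by omega) (by omega)

end Right

end IsRootSystem

theorem finsum_eq_sum_range {M : Type*} [AddCommMonoid M] {N : ℕ}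
    {f : ℕ × ℕ × ℕ × ℕ × ℕ × ℕ → M}
    (hf : ∀ x₁ x₂ x₃ x₄ x₅ x₆, f (x₁, x₂, x₃, x₄, x₅, x₆) ≠ 0 →
      x₁ < N ∧ x₂ < N ∧ x₃ < N ∧ x₄ < N ∧ x₅ < N ∧ x₆ < N) :
    ∑ᶠ v, f v = ∑ x₁ ∈ range N, ∑ x₂ ∈ range N, ∑ x₃ ∈ range N, ∑ x₄ ∈ range N,
      ∑ x₅ ∈ range N, ∑ x₆ ∈ range N, f (x₁, x₂, x₃, x₄, x₅, x₆) := by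
  rw [finsum_eq_sum_of_support_subset (s := range N ×ˢ range N ×ˢ range N ×ˢ range N ×ˢ
    range N ×ˢ range N)]
  · simp only [sum_product]
  · rintro ⟨x₁, x₂, x₃, x₄, x₅, x₆⟩ hx
    simpa using hf _ _ _ _ _ _ hx

theorem sum_reorder_left {M : Type*} [AddCommMonoid M] (s : Finset ℕ)
    (f : ℕ → ℕ → ℕ → ℕ → ℕ → ℕ → M) :
    ∑ x₁ ∈ s, ∑ x₂ ∈ s, ∑ x₃ ∈ s, ∑ x₄ ∈ s, ∑ x₅ ∈ s, ∑ x₆ ∈ s, f x₁ x₂ x₃ x₄ x₅ x₆ =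
      ∑ x₄ ∈ s, ∑ x₅ ∈ s, ∑ x₆ ∈ s, ∑ x₂ ∈ s, ∑ x₃ ∈ s, ∑ x₁ ∈ s, f x₁ x₂ x₃ x₄ x₅ x₆ := by
  simp only [← sum_product']
  refine sum_nbij'
    (fun v => (v.2.2.2.1, v.2.2.2.2.1, v.2.2.2.2.2, v.2.1, v.2.2.1, v.1))
    (fun v => (v.2.2.2.2.2, v.2.2.2.1, v.2.2.2.2.1, v.1, v.2.1, v.2.2.1)) ?_ ?_ ?_ ?_ ?_ <;>
  simp +contextual

theorem sum_reorder_right {M : Type*} [AddCommMonoid M] (s : Finset ℕ)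
    (f : ℕ → ℕ → ℕ → ℕ → ℕ → ℕ → M) :
    ∑ x₁ ∈ s, ∑ x₂ ∈ s, ∑ x₃ ∈ s, ∑ x₄ ∈ s, ∑ x₅ ∈ s, ∑ x₆ ∈ s, f x₁ x₂ x₃ x₄ x₅ x₆ =
      ∑ x₁ ∈ s, ∑ x₂ ∈ s, ∑ x₄ ∈ s, ∑ x₃ ∈ s, ∑ x₅ ∈ s, ∑ x₆ ∈ s, f x₁ x₂ x₃ x₄ x₅ x₆ :=
  sum_congr rfl fun _ _ => sum_congr rfl fun _ _ => sum_comm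

theorem mul₄_ne_zero {w x y z : K} (h : w * x * y * z ≠ 0) : w ≠ 0 ∧ x ≠ 0 ∧ y ≠ 0 ∧ z ≠ 0 := by
  simpa [and_assoc] using h

/-- The tetrahedron equation, from a root system with coordinate functionals. -/
theorem IsRootSystem.tetrahedron {e₁ e₂ e₃ a b c : A} (h : IsRootSystem q e₁ e₂ e₃ a b c)
    {φ : A →ₗ[K] K} {a₁ a₂ a₃ a₄ a₅ a₆ : ℕ}
    (hφ : IsCoordinate q e₁ e₂ e₃ a b c φ a₁ a₂ a₃ a₄ a₅ a₆) (i₁ i₂ i₃ i₄ i₅ i₆ : ℕ) :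
    (∑ᶠ v : ℕ × ℕ × ℕ × ℕ × ℕ × ℕ,
      R3 q a₁ a₂ a₄ v.1 v.2.1 v.2.2.2.1 *
      R3 q v.1 a₃ a₅ i₁ v.2.2.1 v.2.2.2.2.1 *
      R3 q v.2.1 v.2.2.1 a₆ i₂ i₃ v.2.2.2.2.2 *
      R3 q v.2.2.2.1 v.2.2.2.2.1 v.2.2.2.2.2 i₄ i₅ i₆) =
    (∑ᶠ v : ℕ × ℕ × ℕ × ℕ × ℕ × ℕ,
      R3 q a₄ a₅ a₆ v.2.2.2.1 v.2.2.2.2.1 v.2.2.2.2.2 *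
      R3 q a₂ a₃ v.2.2.2.2.2 v.2.1 v.2.2.1 i₆ *
      R3 q a₁ v.2.2.1 v.2.2.2.2.1 v.1 i₃ i₅ *
      R3 q v.1 v.2.1 v.2.2.2.1 i₁ i₂ i₄) := by
  obtain ⟨N, hN⟩ : ∃ N, 8 * (i₁ + i₂ + i₃ + i₄ + i₅ + i₆) +
    (a₁ + a₂ + a₃ + a₄ + a₅ + a₆) < N := ⟨_, Nat.lt_succ_self _⟩
  have haN : a₁ + a₂ + a₃ + a₄ + a₅ + a₆ < N := by omega
  rw [finsum_eq_sum_range (N := N), finsum_eq_sum_range (N := N)]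
  · have key := (h.map_left hφ haN (i₁ := i₁) (i₂ := i₂) (i₃ := i₃) (i₄ := i₄)
      (i₅ := i₅) (i₆ := i₆) (by omega)).symm.trans (h.map_right hφ haN (by omega))
    simp only [mul_sum] at key
    rw [sum_reorder_left]
    conv_rhs => rw [sum_reorder_right]
    refine Eq.trans ?_ (key.trans ?_)
    all_goals
      iterate 6 refine sum_congr rfl fun _ _ => ?_
      ring
  · intro x₁ x₂ x₃ x₄ x₅ x₆ hx
    obtain ⟨h₁, h₂, h₃, -⟩ := mul₄_ne_zero hx
    obtain ⟨c₁, d₁⟩ := R3_conservation h₁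
    obtain ⟨c₂, -⟩ := R3_conservation h₂
    obtain ⟨c₃, -⟩ := R3_conservation h₃
    clear hN hx h₁ h₂ h₃
    dsimp only at c₁ d₁ c₂ c₃
    refine ⟨?_, ?_, ?_, ?_, ?_, ?_⟩ <;> omega
  · intro x₁ x₂ x₃ x₄ x₅ x₆ hx
    obtain ⟨h₁, h₂, h₃, -⟩ := mul₄_ne_zero hx
    obtain ⟨c₁, d₁⟩ := R3_conservation h₁
    obtain ⟨-, d₂⟩ := R3_conservation h₂
    obtain ⟨-, d₃⟩ := R3_conservation h₃
    clear hN hx h₁ h₂ h₃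
    dsimp only at c₁ d₁ d₂ d₃
    refine ⟨?_, ?_, ?_, ?_, ?_, ?_⟩ <;> omega

/-! ### A realization by difference operators in six variables -/

namespace DifferenceOperator

/-- Functions on `ℤ⁶`. -/
abbrev Fun (K : Type) : Type := ℤ → ℤ → ℤ → ℤ → ℤ → ℤ → K

def opE₁ (K : Type) [Field K] : Module.End K (Fun K) where
  toFun f n₁ n₂ n₃ n₄ n₅ n₆ := f (n₁ + 1) n₂ n₃ n₄ n₅ n₆
  map_add' _ _ := rfl
  map_smul' _ _ := rfl

def opE₂ (q : K) : Module.End K (Fun K) where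
  toFun f n₁ n₂ n₃ n₄ n₅ n₆ :=
    q ^ n₁ * (q ^ n₂)⁻¹ * f n₁ n₂ n₃ (n₄ + 1) n₅ n₆ +
      q * ((q ^ n₁)⁻¹ - q ^ n₁) * f (n₁ - 1) (n₂ + 1) n₃ n₄ n₅ n₆
  map_add' f g := by
    funext n₁ n₂ n₃ n₄ n₅ n₆
    simp only [Pi.add_apply]
    ring
  map_smul' r f := by
    funext n₁ n₂ n₃ n₄ n₅ n₆
    simp only [Pi.smul_apply, smul_eq_mul, RingHom.id_apply]
    ring

def opE₃ (q : K) : Module.End K (Fun K) where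
  toFun f n₁ n₂ n₃ n₄ n₅ n₆ :=
    q * ((q ^ n₂)⁻¹ - q ^ n₂) * f n₁ (n₂ - 1) (n₃ + 1) n₄ n₅ n₆ +
      q * q ^ n₂ * (q ^ n₃)⁻¹ * ((q ^ n₄)⁻¹ - q ^ n₄) * f n₁ n₂ n₃ (n₄ - 1) (n₅ + 1) n₆ +
      q ^ n₂ * q ^ n₄ * (q ^ n₃)⁻¹ * (q ^ n₅)⁻¹ * f n₁ n₂ n₃ n₄ n₅ (n₆ + 1)
  map_add' f g := by
    funext n₁ n₂ n₃ n₄ n₅ n₆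
    simp only [Pi.add_apply]
    ring
  map_smul' r f := by
    funext n₁ n₂ n₃ n₄ n₅ n₆
    simp only [Pi.smul_apply, smul_eq_mul, RingHom.id_apply]
    ring

def opA (q : K) : Module.End K (Fun K) where
  toFun f n₁ n₂ n₃ n₄ n₅ n₆ := (q ^ n₁)⁻¹ * f n₁ (n₂ + 1) n₃ n₄ n₅ n₆
  map_add' f g := by
    funext n₁ n₂ n₃ n₄ n₅ n₆
    simp only [Pi.add_apply]
    ring
  map_smul' r f := by
    funext n₁ n₂ n₃ n₄ n₅ n₆
    simp only [Pi.smul_apply, smul_eq_mul, RingHom.id_apply]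
    ring

def opB (q : K) : Module.End K (Fun K) where
  toFun f n₁ n₂ n₃ n₄ n₅ n₆ :=
    q * q ^ n₁ * (q ^ n₂)⁻¹ * ((q ^ n₂)⁻¹ - q ^ n₂) * f n₁ (n₂ - 1) (n₃ + 1) (n₄ + 1) n₅ n₆ +
      q ^ n₁ * (q ^ n₃)⁻¹ * (q ^ n₄)⁻¹ * f n₁ n₂ n₃ n₄ (n₅ + 1) n₆ +
      q * (q ^ n₂)⁻¹ * ((q ^ n₁)⁻¹ - q ^ n₁) * f (n₁ - 1) n₂ (n₃ + 1) n₄ n₅ n₆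
  map_add' f g := by
    funext n₁ n₂ n₃ n₄ n₅ n₆
    simp only [Pi.add_apply]
    ring
  map_smul' r f := by
    funext n₁ n₂ n₃ n₄ n₅ n₆
    simp only [Pi.smul_apply, smul_eq_mul, RingHom.id_apply]
    ring

def opC (q : K) : Module.End K (Fun K) where
  toFun f n₁ n₂ n₃ n₄ n₅ n₆ := (q ^ n₁)⁻¹ * (q ^ n₂)⁻¹ * f n₁ n₂ (n₃ + 1) n₄ n₅ n₆
  map_add' f g := by
    funext n₁ n₂ n₃ n₄ n₅ n₆
    simp only [Pi.add_apply]
    ring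
  map_smul' r f := by
    funext n₁ n₂ n₃ n₄ n₅ n₆
    simp only [Pi.smul_apply, smul_eq_mul, RingHom.id_apply]
    ring

open MulOpposite

theorem isRootSystem (hq : IsGeneric q) :
    IsRootSystem q (op (opE₁ K)) (op (opE₂ q)) (op (opE₃ q)) (op (opA q)) (op (opB q))
      (op (opC q)) := by
  have h0 := hq.ne_zero
  refine ⟨hq, ⟨?_, ?_, ?_⟩, ⟨?_, ?_, ?_⟩, ?_, ?_⟩
  all_goals
    apply unop_injective
    simp only [unop_mul, unop_op, unop_add, unop_smul]
    ext f n₁ n₂ n₃ n₄ n₅ n₆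
    have h₁ := zpow_ne_zero n₁ h0
    have h₂ := zpow_ne_zero n₂ h0
    have h₃ := zpow_ne_zero n₃ h0
    have h₄ := zpow_ne_zero n₄ h0
    have h₅ := zpow_ne_zero n₅ h0
    simp only [Module.End.mul_apply, LinearMap.add_apply, LinearMap.smul_apply, Pi.add_apply,
      Pi.smul_apply, smul_eq_mul, opE₁, opE₂, opE₃, opA, opB, opC, LinearMap.coe_mk,
      AddHom.coe_mk, add_sub_cancel_right, sub_add_cancel, zpow_add_one₀ h0, zpow_sub_one₀ h0]
  all_goals
    generalize q ^ n₁ = x₁ at *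
    generalize q ^ n₂ = x₂ at *
    generalize q ^ n₃ = x₃ at *
    generalize q ^ n₄ = x₄ at *
    generalize q ^ n₅ = x₅ at *
    field_simp
  all_goals ring

theorem pow_apply_of_shift {T : Module.End K (Fun K)} {L : ℤ → Fun K → K}
    (h : ∀ m f, L m (T f) = L (m + 1) f) (f : Fun K) (m : ℤ) (n : ℕ) :
    L m ((T ^ n) f) = L (m + n) f := by
  induction n generalizing m with
  | zero => simp
  | succ n ih => rw [pow_succ', Module.End.mul_apply, h, ih, add_assoc, Nat.cast_succ, add_comm 1]

theorem opE₁_pow_apply (f : Fun K) (n : ℕ) (n₁ n₂ n₃ n₄ n₅ n₆ : ℤ) :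
    (opE₁ K ^ n) f n₁ n₂ n₃ n₄ n₅ n₆ = f (n₁ + n) n₂ n₃ n₄ n₅ n₆ :=
  pow_apply_of_shift (L := fun m f => f m n₂ n₃ n₄ n₅ n₆) (fun _ _ => by simp [opE₁]) f n₁ n

theorem opA_pow_apply (f : Fun K) (n : ℕ) (n₂ n₃ n₄ n₅ n₆ : ℤ) :
    (opA q ^ n) f 0 n₂ n₃ n₄ n₅ n₆ = f 0 (n₂ + n) n₃ n₄ n₅ n₆ :=
  pow_apply_of_shift (L := fun m f => f 0 m n₃ n₄ n₅ n₆) (fun _ _ => by simp [opA]) f n₂ n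

theorem opE₂_pow_apply (f : Fun K) (n : ℕ) (n₃ n₄ n₅ n₆ : ℤ) :
    (opE₂ q ^ n) f 0 0 n₃ n₄ n₅ n₆ = f 0 0 n₃ (n₄ + n) n₅ n₆ :=
  pow_apply_of_shift (L := fun m f => f 0 0 n₃ m n₅ n₆) (fun _ _ => by simp [opE₂]) f n₄ n

theorem opC_pow_apply (f : Fun K) (n : ℕ) (n₃ n₄ n₅ n₆ : ℤ) :
    (opC q ^ n) f 0 0 n₃ n₄ n₅ n₆ = f 0 0 (n₃ + n) n₄ n₅ n₆ :=
  pow_apply_of_shift (L := fun m f => f 0 0 m n₄ n₅ n₆) (fun _ _ => by simp [opC]) f n₃ n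

theorem opB_pow_apply (f : Fun K) (n : ℕ) (n₅ n₆ : ℤ) :
    (opB q ^ n) f 0 0 0 0 n₅ n₆ = f 0 0 0 0 (n₅ + n) n₆ :=
  pow_apply_of_shift (L := fun m f => f 0 0 0 0 m n₆) (fun _ _ => by simp [opB]) f n₅ n

theorem opE₃_pow_apply (f : Fun K) (n : ℕ) (n₆ : ℤ) :
    (opE₃ q ^ n) f 0 0 0 0 0 n₆ = f 0 0 0 0 0 (n₆ + n) :=
  pow_apply_of_shift (L := fun m f => f 0 0 0 0 0 m) (fun _ _ => by simp [opE₃]) f n₆ n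

/-- Applies an operator to `f` and evaluates at the origin. -/
def evalAt (f : Fun K) : (Module.End K (Fun K))ᵐᵒᵖ →ₗ[K] K where
  toFun T := T.unop f 0 0 0 0 0 0
  map_add' _ _ := rfl
  map_smul' _ _ := rfl

theorem evalAt_word (f : Fun K) (i₁ i₂ i₃ i₄ i₅ i₆ : ℕ) :
    evalAt f (qpow q (op (opE₁ K)) i₁ * qpow q (op (opA q)) i₂ * qpow q (op (opE₂ q)) i₄ *
        qpow q (op (opC q)) i₃ * qpow q (op (opB q)) i₅ * qpow q (op (opE₃ q)) i₆) =
      q ^ (i₁.choose 2 + i₂.choose 2 + i₃.choose 2 + i₄.choose 2 + i₅.choose 2 + i₆.choose 2) *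
        f i₁ i₂ i₃ i₄ i₅ i₆ := by
  simp only [qpow, smul_mul_assoc, mul_smul_comm, map_smul, smul_eq_mul]
  have : evalAt f (op (opE₁ K) ^ i₁ * op (opA q) ^ i₂ * op (opE₂ q) ^ i₄ * op (opC q) ^ i₃ *
      op (opB q) ^ i₅ * op (opE₃ q) ^ i₆) = f i₁ i₂ i₃ i₄ i₅ i₆ := by
    change (opE₃ q ^ i₆) ((opB q ^ i₅) ((opC q ^ i₃) ((opE₂ q ^ i₄) ((opA q ^ i₂)
      ((opE₁ K ^ i₁) f))))) 0 0 0 0 0 0 = _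
    simp only [opE₁_pow_apply, opE₂_pow_apply, opE₃_pow_apply, opA_pow_apply, opB_pow_apply,
      opC_pow_apply, zero_add]
  rw [this]
  ring

theorem exists_isCoordinate (hq : IsGeneric q) (a₁ a₂ a₃ a₄ a₅ a₆ : ℕ) :
    ∃ φ : (Module.End K (Fun K))ᵐᵒᵖ →ₗ[K] K,
      IsCoordinate q (op (opE₁ K)) (op (opE₂ q)) (op (opE₃ q)) (op (opA q)) (op (opB q))
        (op (opC q)) φ a₁ a₂ a₃ a₄ a₅ a₆ := by
  refine ⟨evalAt fun n₁ n₂ n₃ n₄ n₅ n₆ =>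
    if (a₁ = n₁ ∧ a₂ = n₂ ∧ a₄ = n₄) ∧ a₃ = n₃ ∧ a₅ = n₅ ∧ a₆ = n₆ then
      (q ^ (a₁.choose 2 + a₂.choose 2 + a₃.choose 2 + a₄.choose 2 + a₅.choose 2 +
        a₆.choose 2))⁻¹ else 0, fun i₁ i₂ i₃ i₄ i₅ i₆ => ?_⟩
  rw [evalAt_word]
  simp only [Nat.cast_inj]
  split_ifs with hi
  · obtain ⟨⟨rfl, rfl, rfl⟩, rfl, rfl, rfl⟩ := hi
    exact mul_inv_cancel₀ (pow_ne_zero _ hq.ne_zero)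
  · exact mul_zero _

end DifferenceOperator

theorem isGeneric_ratFunc_X : IsGeneric (RatFunc.X : RatFunc ℚ) := by
  refine ⟨RatFunc.X_ne_zero, fun n h => ?_⟩
  rw [sub_eq_zero, ← RatFunc.algebraMap_X, ← map_pow, ← map_pow,
    ← map_one (algebraMap (Polynomial ℚ) (RatFunc ℚ))] at h
  have := congrArg Polynomial.natDegree (RatFunc.algebraMap_injective ℚ h)
  rw [← pow_mul, Polynomial.natDegree_X_pow, Polynomial.natDegree_one] at this
  omega

end QuantumAlgebra

/-- The tetrahedron equation `R₁₂₄ R₁₃₅ R₂₃₆ R₄₅₆ = R₄₅₆ R₂₃₆ R₁₃₅ R₁₂₄` in component form,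
with `v = (j₁,j₂,j₃,j₄,j₅,j₆)` running over ℕ⁶ (finitely many nonzero terms). -/
theorem tetrahedron_equation (a₁ a₂ a₃ a₄ a₅ a₆ i₁ i₂ i₃ i₄ i₅ i₆ : ℕ) :
    (∑ᶠ v : ℕ × ℕ × ℕ × ℕ × ℕ × ℕ,
      R3 (RatFunc.X : RatFunc ℚ) a₁ a₂ a₄ v.1 v.2.1 v.2.2.2.1 *
      R3 (RatFunc.X : RatFunc ℚ) v.1 a₃ a₅ i₁ v.2.2.1 v.2.2.2.2.1 *
      R3 (RatFunc.X : RatFunc ℚ) v.2.1 v.2.2.1 a₆ i₂ i₃ v.2.2.2.2.2 *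
      R3 (RatFunc.X : RatFunc ℚ) v.2.2.2.1 v.2.2.2.2.1 v.2.2.2.2.2 i₄ i₅ i₆) =
    (∑ᶠ v : ℕ × ℕ × ℕ × ℕ × ℕ × ℕ,
      R3 (RatFunc.X : RatFunc ℚ) a₄ a₅ a₆ v.2.2.2.1 v.2.2.2.2.1 v.2.2.2.2.2 *
      R3 (RatFunc.X : RatFunc ℚ) a₂ a₃ v.2.2.2.2.2 v.2.1 v.2.2.1 i₆ *
      R3 (RatFunc.X : RatFunc ℚ) a₁ v.2.2.1 v.2.2.2.2.1 v.1 i₃ i₅ *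
      R3 (RatFunc.X : RatFunc ℚ) v.1 v.2.1 v.2.2.2.1 i₁ i₂ i₄) := by
  obtain ⟨φ, hφ⟩ := DifferenceOperator.exists_isCoordinate isGeneric_ratFunc_X a₁ a₂ a₃ a₄ a₅ a₆
  exact (DifferenceOperator.isRootSystem isGeneric_ratFunc_X).tetrahedron hφ i₁ i₂ i₃ i₄ i₅ i₆
end
end

section
/- Define χ₁(z)_m = z^m/(q;q)_m for m ∈ ℕ, and χ₂(z)_m = z^{m/2}/(q⁴;q⁴)_{m/2} if m is even and χ₂(z)_m = 0 if m is odd (these are the coefficients of the boundary vectors |χ_s(z)⟩ = Σ_m χ_s(z)_m |m⟩). Then for each s ∈ {1,2} the following hold as identities of polynomials in x and y over ℚ(q) (all sums are finite because R^{a,b,c}_{i,j,k} = 0 unless a+b = i+j and b+c = j+k): (a) for all a,b,c ∈ ℕ: Σ_{i,j,k ≥ 0} R^{a,b,c}_{i,j,k} χ_s(x)_i χ_s(xy)_j χ_s(y)_k = χ_s(x)_a χ_s(xy)_b χ_s(y)_c; (b) for all i,j,k ∈ ℕ: Σ_{a,b,c ≥ 0} (q²;q²)_a (q²;q²)_b (q²;q²)_c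 χ_s(x)_a χ_s(xy)_b χ_s(y)_c R^{a,b,c}_{i,j,k} = (q²;q²)_i (q²;q²)_j (q²;q²)_k χ_s(x)_i χ_s(xy)_j χ_s(y)_k. These are the component forms of R|χ_s(x)⟩⊗|χ_s(xy)⟩⊗|χ_s(y)⟩ = |χ_s(x)⟩⊗|χ_s(xy)⟩⊗|χ_s(y)⟩ and of the dual relation ⟨χ_s(x,y)|R = ⟨χ_s(x,y)|. -/
/- The boundary vectors |χ_s(z)⟩ are fixed by the 3d R matrix:
`R |χ_s(x)⟩⊗|χ_s(xy)⟩⊗|χ_s(y)⟩ = |χ_s(x)⟩⊗|χ_s(xy)⟩⊗|χ_s(y)⟩` and the dual relation,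
in component form, for s = 1, 2.  (Identities of polynomials in x,y over ℚ(q) are stated
as identities for all x, y in the infinite field ℚ(q), which is equivalent.) -/

noncomputable section
open Finset

/-- Coefficients of the boundary vector `|χ₁(z)⟩ = Σ_m z^m/(q;q)_m |m⟩`. -/
def chi1 {K : Type} [Field K] (q z : K) (m : ℕ) : K := z ^ m / poch q q m

/-- Coefficients of the boundary vector `|χ₂(z)⟩ = Σ_m z^m/(q⁴;q⁴)_m |2m⟩`. -/
def chi2 {K : Type} [Field K] (q z : K) (m : ℕ) : K :=
  if m % 2 = 0 then z ^ (m / 2) / poch (q ^ 4) (q ^ 4) (m / 2) else 0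

section Pochhammer

variable {K : Type} [Field K]

lemma poch_zero_s2 (x p : K) : poch x p 0 = 1 := by simp [poch]

lemma poch_self_succ (p : K) (n : ℕ) : poch p p (n + 1) = poch p p n * (1 - p ^ (n + 1)) := by
  rw [poch, poch, prod_range_succ, pow_succ']

lemma poch_self_ne_zero {p : K} (hp : ∀ n : ℕ, 1 - p ^ (n + 1) ≠ 0) (n : ℕ) :
    poch p p n ≠ 0 := by
  induction n with
  | zero => simp [poch_zero_s2]
  | succ n ih => rw [poch_self_succ]; exact mul_ne_zero ih (hp n)

lemma qbinom_zero_right_s2 {p : K} (hp : ∀ n : ℕ, 1 - p ^ (n + 1) ≠ 0) (m : ℕ) :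
    qbinom p m 0 = 1 := by
  simp [qbinom, poch_zero_s2, poch_self_ne_zero hp m]

lemma qbinom_self {p : K} (hp : ∀ n : ℕ, 1 - p ^ (n + 1) ≠ 0) (m : ℕ) :
    qbinom p m m = 1 := by
  simp [qbinom, poch_zero_s2, poch_self_ne_zero hp m]

lemma qbinom_of_lt (p : K) {m n : ℕ} (h : m < n) : qbinom p m n = 0 := by
  simp [qbinom, h]

lemma qbinom_add (p : K) (n d : ℕ) :
    qbinom p (n + d) n = poch p p (n + d) / (poch p p n * poch p p d) := by
  simp [qbinom]

/-- First `q`-Pascal rule. -/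
lemma qbinom_succ_succ {p : K} (hp : ∀ n : ℕ, 1 - p ^ (n + 1) ≠ 0) (m n : ℕ) :
    qbinom p (m + 1) (n + 1) = p ^ (n + 1) * qbinom p m (n + 1) + qbinom p m n := by
  rcases lt_trichotomy m n with h | rfl | h
  · simp [qbinom_of_lt p h, qbinom_of_lt p (Nat.lt_succ_of_lt h),
      qbinom_of_lt p (Nat.succ_lt_succ h)]
  · simp [qbinom_self hp, qbinom_of_lt p (Nat.lt_succ_self m)]
  · obtain ⟨d, rfl⟩ := Nat.exists_eq_add_of_lt h
    have h1 := qbinom_add p (n + 1) (d + 1)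
    have h2 := qbinom_add p (n + 1) d
    have h3 := qbinom_add p n (d + 1)
    rw [show n + 1 + (d + 1) = n + d + 1 + 1 by ring] at h1
    rw [show n + 1 + d = n + d + 1 by ring] at h2
    rw [show n + (d + 1) = n + d + 1 by ring] at h3
    rw [h1, h2, h3, poch_self_succ p (n + d + 1), poch_self_succ p n, poch_self_succ p d]
    have := poch_self_ne_zero hp n
    have := poch_self_ne_zero hp d
    have := hp n
    have := hp d
    field_simp
    ring

/-- Second `q`-Pascal rule. -/
lemma qbinom_succ_succ' {p : K} (hp : ∀ n : ℕ, 1 - p ^ (n + 1) ≠ 0) (m n : ℕ) :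
    qbinom p (m + 1) (n + 1) = qbinom p m (n + 1) + p ^ (m - n) * qbinom p m n := by
  rcases lt_trichotomy m n with h | rfl | h
  · simp [qbinom_of_lt p h, qbinom_of_lt p (Nat.lt_succ_of_lt h),
      qbinom_of_lt p (Nat.succ_lt_succ h)]
  · simp [qbinom_self hp, qbinom_of_lt p (Nat.lt_succ_self m)]
  · obtain ⟨d, rfl⟩ := Nat.exists_eq_add_of_lt h
    have h1 := qbinom_add p (n + 1) (d + 1)
    have h2 := qbinom_add p (n + 1) d
    have h3 := qbinom_add p n (d + 1)
    rw [show n + 1 + (d + 1) = n + d + 1 + 1 by ring] at h1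
    rw [show n + 1 + d = n + d + 1 by ring] at h2
    rw [show n + (d + 1) = n + d + 1 by ring] at h3
    rw [h1, h2, h3, poch_self_succ p (n + d + 1), poch_self_succ p n, poch_self_succ p d,
      show n + d + 1 - n = d + 1 by omega]
    have := poch_self_ne_zero hp n
    have := poch_self_ne_zero hp d
    have := hp n
    have := hp d
    field_simp
    ring

end Pochhammer

section Oscillators

variable {K : Type} [Field K]

/-- The sequence `u` moved one step to the right, starting with `0`. -/
def shiftRight (u : ℕ → K) : ℕ → K
  | 0 => 0
  | n + 1 => u n

@[simp] lemma shiftRight_zero (u : ℕ → K) : shiftRight u 0 = 0 := rfl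

@[simp] lemma shiftRight_succ (u : ℕ → K) (n : ℕ) : shiftRight u (n + 1) = u n := rfl

/-- The creation operator on the second site. -/
def create₂ : (ℕ → ℕ → ℕ → K) →ₗ[K] (ℕ → ℕ → ℕ → K) where
  toFun ψ a b c := shiftRight (fun b' => ψ a b' c) b
  map_add' ψ φ := by funext a b c; cases b <;> simp
  map_smul' t ψ := by funext a b c; cases b <;> simp

/-- The image `a₁⁺ a₃⁺ - q k₁ k₃ a₂⁺` of the creation operator `a₂⁺` under conjugation
by the 3d R matrix. -/
def dressedCreate (q : K) : (ℕ → ℕ → ℕ → K) →ₗ[K] (ℕ → ℕ → ℕ → K) where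
  toFun ψ a b c := shiftRight (fun a' => shiftRight (fun c' => ψ a' b c') c) a
    - q ^ (a + c + 1) * shiftRight (fun b' => ψ a b' c) b
  map_add' ψ φ := by funext a b c; cases a <;> cases b <;> cases c <;> simp <;> ring
  map_smul' t ψ := by funext a b c; cases a <;> cases b <;> cases c <;> simp <;> ring

/-- The image `a₁⁻ a₃⁻ - q k₁ k₃ a₂⁻` of the annihilation operator `a₂⁻` under conjugation
by the 3d R matrix. -/
def dressedAnnihilate (q : K) : (ℕ → ℕ → ℕ → K) →ₗ[K] (ℕ → ℕ → ℕ → K) where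
  toFun ψ a b c := (1 - q ^ (2 * a + 2)) * (1 - q ^ (2 * c + 2)) * ψ (a + 1) b (c + 1)
    - q ^ (a + c + 1) * (1 - q ^ (2 * b + 2)) * ψ a (b + 1) c
  map_add' ψ φ := by funext a b c; simp; ring
  map_smul' t ψ := by funext a b c; simp; ring

/-- The image `k₃ a₁⁺ + k₁ a₂⁺ a₃⁻` of `k₂ a₁⁺` under conjugation by the 3d R matrix. -/
def dressedHop (q : K) : (ℕ → ℕ → ℕ → K) →ₗ[K] (ℕ → ℕ → ℕ → K) where
  toFun ψ a b c := q ^ c * shiftRight (fun a' => ψ a' b c) a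
    + q ^ a * (1 - q ^ (2 * c + 2)) * shiftRight (fun b' => ψ a b' (c + 1)) b
  map_add' ψ φ := by funext a b c; cases a <;> cases b <;> simp <;> ring
  map_smul' t ψ := by funext a b c; cases a <;> cases b <;> simp <;> ring

lemma create₂_apply (ψ : ℕ → ℕ → ℕ → K) (a b c : ℕ) :
    create₂ ψ a b c = shiftRight (fun b' => ψ a b' c) b := rfl

lemma dressedCreate_apply (q : K) (ψ : ℕ → ℕ → ℕ → K) (a b c : ℕ) :
    dressedCreate q ψ a b c = shiftRight (fun a' => shiftRight (fun c' => ψ a' b c') c) a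
      - q ^ (a + c + 1) * shiftRight (fun b' => ψ a b' c) b := rfl

lemma dressedAnnihilate_apply (q : K) (ψ : ℕ → ℕ → ℕ → K) (a b c : ℕ) :
    dressedAnnihilate q ψ a b c =
      (1 - q ^ (2 * a + 2)) * (1 - q ^ (2 * c + 2)) * ψ (a + 1) b (c + 1)
        - q ^ (a + c + 1) * (1 - q ^ (2 * b + 2)) * ψ a (b + 1) c := rfl

lemma dressedHop_apply (q : K) (ψ : ℕ → ℕ → ℕ → K) (a b c : ℕ) :
    dressedHop q ψ a b c = q ^ c * shiftRight (fun a' => ψ a' b c) a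
      + q ^ a * (1 - q ^ (2 * c + 2)) * shiftRight (fun b' => ψ a b' (c + 1)) b := rfl

lemma dressedCreate_create₂ (q : K) (ψ : ℕ → ℕ → ℕ → K) :
    dressedCreate q (create₂ ψ) = create₂ (dressedCreate q ψ) := by
  funext a b c
  cases a <;> cases b <;> cases c <;> simp [dressedCreate_apply, create₂_apply]

lemma dressedHop_create₂ (q : K) (ψ : ℕ → ℕ → ℕ → K) :
    dressedHop q (create₂ ψ) = create₂ (dressedHop q ψ) := by
  funext a b c
  cases a <;> cases b <;> simp [dressedHop_apply, create₂_apply]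

lemma dressedAnnihilate_create₂ (q : K) (ψ : ℕ → ℕ → ℕ → K) (a b c : ℕ) :
    dressedAnnihilate q (create₂ ψ) a b c = create₂ (dressedAnnihilate q ψ) a b c
      - (1 - q ^ 2) * q ^ (a + 2 * b + c + 1) * ψ a b c := by
  cases b <;> simp only [dressedAnnihilate_apply, create₂_apply, shiftRight_zero,
    shiftRight_succ] <;> ring

end Oscillators

section RMatrix

variable {K : Type} [Field K] {q : K}

lemma one_sub_sq_pow_ne_zero (hq : ∀ n : ℕ, 1 - q ^ (n + 1) ≠ 0) (n : ℕ) :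
    1 - (q ^ 2) ^ (n + 1) ≠ 0 := by
  rw [← pow_mul]
  exact hq (2 * n + 1)

lemma poch_sq_succ (q : K) (n : ℕ) :
    poch (q ^ 2) (q ^ 2) (n + 1) = poch (q ^ 2) (q ^ 2) n * (1 - q ^ (2 * n + 2)) := by
  rw [poch_self_succ, ← pow_mul, mul_add, mul_one]

lemma poch_sq_ne_zero (hq : ∀ n : ℕ, 1 - q ^ (n + 1) ≠ 0) (n : ℕ) :
    poch (q ^ 2) (q ^ 2) n ≠ 0 :=
  poch_self_ne_zero (one_sub_sq_pow_ne_zero hq) n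

lemma inv_poch_sq (hq : ∀ n : ℕ, 1 - q ^ (n + 1) ≠ 0) (n : ℕ) :
    (poch (q ^ 2) (q ^ 2) n)⁻¹ = (1 - q ^ (2 * n + 2)) * (poch (q ^ 2) (q ^ 2) (n + 1))⁻¹ := by
  have := hq (2 * n + 1)
  rw [poch_sq_succ]
  field_simp

lemma R3_of_not {a b c i j k : ℕ} (h : ¬ (a + b = i + j ∧ b + c = j + k)) :
    R3 q a b c i j k = 0 := if_neg h

lemma R3_zero_snd (hq : ∀ n : ℕ, 1 - q ^ (n + 1) ≠ 0) (a c i j k : ℕ) :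
    R3 q a 0 c i j k = if a = i + j ∧ c = j + k then q ^ (i * k) else 0 := by
  unfold R3
  simp only [add_zero, zero_add]
  split_ifs with h
  · have hc := poch_sq_ne_zero hq c
    obtain ⟨rfl, rfl⟩ := h
    simp [qbinom_zero_right_s2 (one_sub_sq_pow_ne_zero hq), hc]
    exact_mod_cast rfl
  · rfl

lemma R3_zero_fifth (hq0 : q ≠ 0) (hq : ∀ n : ℕ, 1 - q ^ (n + 1) ≠ 0) (a b c i k : ℕ) :
    R3 q a b c i 0 k = if a + b = i ∧ b + c = k then
      q ^ (a * c) * (poch (q ^ 2) (q ^ 2) i * poch (q ^ 2) (q ^ 2) k *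
        ((poch (q ^ 2) (q ^ 2) a)⁻¹ * (poch (q ^ 2) (q ^ 2) b)⁻¹ * (poch (q ^ 2) (q ^ 2) c)⁻¹))
      else 0 := by
  unfold R3
  simp only [add_zero, zero_add]
  split_ifs with h
  · have hp := one_sub_sq_pow_ne_zero hq
    have ha := poch_sq_ne_zero hq a
    have hb := poch_sq_ne_zero hq b
    have hc := poch_sq_ne_zero hq c
    obtain ⟨rfl, rfl⟩ := h
    rw [sum_eq_single_of_mem 0 (by simp)]
    · rw [qbinom_zero_right_s2 hp, Nat.sub_zero, add_comm a b, qbinom_add, add_comm c b,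
        show ((b + a : ℕ) : ℤ) * ((c : ℤ) - ((0 : ℕ) : ℤ)) + (((b + c : ℕ) : ℤ) + 1) * ((0 : ℕ) : ℤ)
          + ((b : ℤ) - ((0 : ℕ) : ℤ)) * ((b : ℤ) - ((0 : ℕ) : ℤ) - ((b + c : ℕ) : ℤ))
          = ((a * c : ℕ) : ℤ) by push_cast; ring, zpow_natCast]
      field_simp
    · intro l _ hl
      rw [qbinom_of_lt _ (Nat.pos_of_ne_zero hl), mul_zero]
  · rfl

/-- The relation `a₂⁺ R = R (a₁⁺ a₃⁺ - q k₁ k₃ a₂⁺)` on components. -/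
lemma R3_fifth_succ (hq0 : q ≠ 0) (hq : ∀ n : ℕ, 1 - q ^ (n + 1) ≠ 0) (a b c i j k : ℕ) :
    q ^ (i + k + 1) * R3 q a b c i (j + 1) k =
      R3 q a b c (i + 1) j (k + 1) - shiftRight (fun b' => R3 q a b' c i j k) b := by
  have hp := one_sub_sq_pow_ne_zero hq
  rcases b with _ | b
  · simp only [R3_zero_snd hq, shiftRight_zero, sub_zero,
      show i + (j + 1) = i + 1 + j by ring, show j + (k + 1) = j + 1 + k by ring]
    split_ifs
    · ring
    · simp
  rw [shiftRight_succ]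
  by_cases h : a + b = i + j ∧ b + c = j + k
  swap
  · rw [R3_of_not (by omega), R3_of_not (by omega), R3_of_not h]; simp
  have hc := poch_sq_ne_zero hq c
  unfold R3
  rw [if_pos h, if_pos (by omega), if_pos (by omega)]
  have hcz : (c : ℤ) = j + k - b := by have := h.2; omega
  set P : ℕ → K := fun m => poch (q ^ 2) (q ^ 2) (c + m) / poch (q ^ 2) (q ^ 2) c with hP
  have hPsucc : ∀ m, P (m + 1) = P m * (1 - (q ^ 2) ^ (c + m + 1)) := fun m => by
    simp only [hP]
    rw [← add_assoc, poch_self_succ]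
    ring
  set e : ℕ → ℤ := fun l => (i : ℤ) * ((c : ℤ) - (j : ℤ)) + ((k : ℤ) + 1) * (l : ℤ)
    + ((b : ℤ) - (l : ℤ)) * ((b : ℤ) - (l : ℤ) - (k : ℤ)) with he
  set U : ℕ → K := fun l => (-1) ^ l * q ^ e l * P (b + 1 - l) *
    shiftRight (fun m => qbinom (q ^ 2) i m) (b + 1 - l) * qbinom (q ^ 2) j l with hU
  set V : ℕ → K := shiftRight fun l => (-1) ^ (l + 1) * (q ^ e l * (q ^ 2) ^ (k + 1)) * P (b - l) *
    qbinom (q ^ 2) i (b - l) * ((q ^ 2) ^ (j - l) * qbinom (q ^ 2) j l) with hV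
  have hbinom_i : ∀ m, qbinom (q ^ 2) (i + 1) m =
      (q ^ 2) ^ m * qbinom (q ^ 2) i m + shiftRight (fun m => qbinom (q ^ 2) i m) m := by
    rintro (_ | m)
    · simp [qbinom_zero_right_s2 hp]
    · exact qbinom_succ_succ hp i m
  have hbinom_j : ∀ l, qbinom (q ^ 2) (j + 1) l = qbinom (q ^ 2) j l +
      shiftRight (fun l => (q ^ 2) ^ (j - l) * qbinom (q ^ 2) j l) l := by
    rintro (_ | l)
    · simp [qbinom_zero_right_s2 hp]
    · exact qbinom_succ_succ' hp j l
  have hUsum : ∑ l ∈ range (b + 1 + 1), U l = ∑ l ∈ range (b + 1), U l := by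
    rw [sum_range_succ]
    simp [hU]
  have hVsum : ∑ l ∈ range (b + 1 + 1), V l = ∑ l ∈ range (b + 1), V (l + 1) := by
    rw [sum_range_succ']
    simp [hV]
  rw [mul_sum, eq_sub_iff_add_eq, ← eq_sub_iff_add_eq', ← sum_sub_distrib]
  trans ∑ l ∈ range (b + 1), (U l - V (l + 1))
  · refine sum_congr rfl fun l hl => ?_
    obtain ⟨m, rfl⟩ := Nat.exists_eq_add_of_le (Nat.lt_succ_iff.1 (mem_range.1 hl))
    rw [hU, hV]
    simp only [shiftRight_succ, show l + m + 1 - l = m + 1 by omega, Nat.add_sub_cancel_left,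
      hPsucc]
    rcases lt_or_ge j l with hjl | hjl
    · simp [qbinom_of_lt _ hjl]
    · have hexp : (q ^ 2) ^ (c + m + 1) = (q ^ 2) ^ (k + 1) * (q ^ 2) ^ (j - l) := by
        rw [← pow_add]
        congr 1
        omega
      rw [hexp]
      ring
  · rw [sum_sub_distrib, ← hUsum, ← hVsum, ← sum_sub_distrib]
    refine sum_congr rfl fun l hl => ?_
    obtain ⟨m, hm⟩ := Nat.exists_eq_add_of_le (Nat.lt_succ_iff.1 (mem_range.1 hl))
    have hbz : (b : ℤ) = l + m - 1 := by omega
    have hml : b + 1 - l = m := by omega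
    rw [hbinom_i, hbinom_j, hml]
    have hp_pow : ∀ n : ℕ, (q ^ 2) ^ n = q ^ (2 * (n : ℤ)) := fun n => by
      rw [← pow_mul, ← zpow_natCast]
      push_cast
      rfl
    have h1 : q ^ (((i + 1 : ℕ) : ℤ) * ((c : ℤ) - (j : ℤ)) + (((k + 1 : ℕ) : ℤ) + 1) * (l : ℤ)
        + (((b + 1 : ℕ) : ℤ) - (l : ℤ)) * (((b + 1 : ℕ) : ℤ) - (l : ℤ) - ((k + 1 : ℕ) : ℤ)))
        = q ^ e l := by
      congr 1
      simp only [he, hcz]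
      push_cast [hbz]
      ring
    have h2 : q ^ (i + k + 1) * q ^ ((i : ℤ) * ((c : ℤ) - ((j + 1 : ℕ) : ℤ))
        + ((k : ℤ) + 1) * (l : ℤ)
        + (((b + 1 : ℕ) : ℤ) - (l : ℤ)) * (((b + 1 : ℕ) : ℤ) - (l : ℤ) - (k : ℤ)))
        = q ^ e l * (q ^ 2) ^ m := by
      rw [← zpow_natCast q (i + k + 1), hp_pow, ← zpow_add₀ hq0, ← zpow_add₀ hq0]
      congr 1
      simp only [he, hcz]
      push_cast [hbz]
      ring
    have h3 : V l = (-1) ^ l * (q ^ e l * (q ^ 2) ^ m) * P m * qbinom (q ^ 2) i m *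
        shiftRight (fun l => (q ^ 2) ^ (j - l) * qbinom (q ^ 2) j l) l := by
      rcases l with _ | l
      · simp [hV]
      · have hml' : b - l = m := by omega
        simp only [hV, shiftRight_succ, hml']
        have : q ^ e l * (q ^ 2) ^ (k + 1) = q ^ e (l + 1) * (q ^ 2) ^ m := by
          rw [hp_pow, hp_pow, ← zpow_add₀ hq0, ← zpow_add₀ hq0]
          congr 1
          simp only [he]
          push_cast [hbz]
          ring
        rw [this]
    rw [h1, h3]
    simp only [hU, hml]
    linear_combination (-1) ^ l * P m * qbinom (q ^ 2) i m * (qbinom (q ^ 2) j l +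
      shiftRight (fun l => (q ^ 2) ^ (j - l) * qbinom (q ^ 2) j l) l) * h2

end RMatrix

section Intertwining

variable {K : Type} [Field K] {q : K}

/-- The vector `R |i, j, k⟩`. -/
def RVec (q : K) (i j k : ℕ) : ℕ → ℕ → ℕ → K := fun a b c => R3 q a b c i j k

lemma RVec_fifth_succ (hq0 : q ≠ 0) (hq : ∀ n : ℕ, 1 - q ^ (n + 1) ≠ 0) (i j k : ℕ) :
    q ^ (i + k + 1) • RVec q i (j + 1) k = RVec q (i + 1) j (k + 1) - create₂ (RVec q i j k) := by
  funext a b c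
  exact R3_fifth_succ hq0 hq a b c i j k

lemma RVec_fifth_one (hq0 : q ≠ 0) (hq : ∀ n : ℕ, 1 - q ^ (n + 1) ≠ 0) (i k : ℕ) :
    RVec q (i + 1) 0 (k + 1) - create₂ (RVec q i 0 k) =
      q ^ (i + k + 1) • dressedCreate q (RVec q i 0 k) := by
  have hu := inv_poch_sq hq
  funext a b c
  simp only [Pi.sub_apply, Pi.smul_apply, smul_eq_mul, create₂_apply, dressedCreate_apply, RVec,
    R3_zero_fifth hq0 hq]
  by_cases h : a + b = i + 1 ∧ b + c = k + 1
  swap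
  · rw [if_neg h]
    rcases a with _ | a <;> rcases b with _ | b <;> rcases c with _ | c <;>
      simp only [shiftRight_zero, shiftRight_succ] <;>
      repeat rw [if_neg (by omega)]
    all_goals ring
  · refine mul_left_cancel₀ hq0 ?_
    rw [if_pos h, poch_sq_succ q i, poch_sq_succ q k, ← mul_assoc q (q ^ _), ← pow_succ',
      show i + k + 1 + 1 = a + 2 * b + c by omega, show 2 * i + 2 = 2 * (a + b) by omega,
      show 2 * k + 2 = 2 * (b + c) by omega]
    rcases a with _ | a <;> rcases b with _ | b <;> rcases c with _ | c <;>
      simp only [shiftRight_zero, shiftRight_succ] <;>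
      (repeat rw [if_pos (by omega)]) <;>
      (try rw [hu a]) <;> (try rw [hu b]) <;> (try rw [hu c]) <;> ring

lemma RVec_succ_snd (hq0 : q ≠ 0) (hq : ∀ n : ℕ, 1 - q ^ (n + 1) ≠ 0) (i j k : ℕ) :
    RVec q i (j + 1) k = dressedCreate q (RVec q i j k) := by
  refine smul_right_injective _ (pow_ne_zero (i + k + 1) hq0) ?_
  simp only
  rw [RVec_fifth_succ hq0 hq]
  induction j generalizing i k with
  | zero => exact RVec_fifth_one hq0 hq i k
  | succ j ih =>
    have ih' (i k : ℕ) : RVec q i (j + 1) k = dressedCreate q (RVec q i j k) :=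
      smul_right_injective _ (pow_ne_zero (i + k + 1) hq0)
        ((RVec_fifth_succ hq0 hq i j k).trans (ih i k))
    rw [ih', ih', ← dressedCreate_create₂, ← map_sub, ← RVec_fifth_succ hq0 hq, map_smul, ih']

lemma dressedHop_RVec (hq0 : q ≠ 0) (hq : ∀ n : ℕ, 1 - q ^ (n + 1) ≠ 0) (i j k : ℕ) :
    dressedHop q (RVec q i j k) = q ^ j • RVec q (i + 1) j k := by
  have hu := inv_poch_sq hq
  induction j generalizing i k with
  | zero =>
    funext a b c
    simp only [Pi.smul_apply, smul_eq_mul, dressedHop_apply, RVec, R3_zero_fifth hq0 hq]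
    by_cases h : a + b = i + 1 ∧ b + c = k
    swap
    · rw [if_neg h]
      rcases a with _ | a <;> rcases b with _ | b <;>
        simp only [shiftRight_zero, shiftRight_succ] <;>
        repeat rw [if_neg (by omega)]
      all_goals ring
    · rw [if_pos h, poch_sq_succ q i, show 2 * i + 2 = 2 * (a + b) by omega, hu c]
      rcases a with _ | a <;> rcases b with _ | b <;>
        simp only [shiftRight_zero, shiftRight_succ] <;>
        (repeat rw [if_pos (by omega)]) <;>
        (try rw [hu a]) <;> (try rw [hu b]) <;> ring
  | succ j ih =>
    refine smul_right_injective _ (pow_ne_zero (i + k + 1) hq0) ?_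
    simp only
    rw [← map_smul, RVec_fifth_succ hq0 hq, map_sub, dressedHop_create₂, ih, ih, map_smul,
      ← smul_sub, ← RVec_fifth_succ hq0 hq, smul_smul, smul_smul]
    congr 1
    ring

lemma pow_mul_RVec (q : K) (i j k a b c : ℕ) :
    q ^ (a + 2 * b + c + 1) * RVec q i j k a b c =
      q ^ (i + 2 * j + k + 1) * RVec q i j k a b c := by
  by_cases h : a + b = i + j ∧ b + c = j + k
  · rw [show a + 2 * b + c + 1 = i + 2 * j + k + 1 by omega]
  · simp [RVec, R3_of_not h]

lemma dressedAnnihilate_RVec_zero (hq0 : q ≠ 0) (hq : ∀ n : ℕ, 1 - q ^ (n + 1) ≠ 0) (i k : ℕ) :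
    dressedAnnihilate q (RVec q i 0 k) = 0 := by
  have hu := inv_poch_sq hq
  funext a b c
  simp only [dressedAnnihilate_apply, RVec, R3_zero_fifth hq0 hq, Pi.zero_apply]
  by_cases h : a + 1 + b = i ∧ b + (c + 1) = k
  · rw [if_pos h, if_pos (by omega), hu a, hu b, hu c]
    ring
  · rw [if_neg h, if_neg (by omega)]
    ring

lemma dressedAnnihilate_RVec_succ (hq0 : q ≠ 0) (hq : ∀ n : ℕ, 1 - q ^ (n + 1) ≠ 0) (i j k : ℕ) :
    dressedAnnihilate q (RVec q i (j + 1) k) = (1 - q ^ (2 * j + 2)) • RVec q i j k := by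
  induction j generalizing i k with
  | zero =>
    refine smul_right_injective _ (pow_ne_zero (i + k + 1) hq0) ?_
    simp only
    rw [← map_smul, RVec_fifth_succ hq0 hq, map_sub, dressedAnnihilate_RVec_zero hq0 hq]
    funext a b c
    simp only [Pi.sub_apply, Pi.smul_apply, dressedAnnihilate_create₂,
      dressedAnnihilate_RVec_zero hq0 hq, map_zero, Pi.zero_apply, smul_eq_mul]
    linear_combination (1 - q ^ 2) * pow_mul_RVec q i 0 k a b c
  | succ j ih =>
    refine smul_right_injective _ (pow_ne_zero (i + k + 1) hq0) ?_
    simp only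
    rw [← map_smul, RVec_fifth_succ hq0 hq, map_sub, ih]
    funext a b c
    have h := congrFun (congrFun (congrFun (RVec_fifth_succ hq0 hq i j k) a) b) c
    simp only [Pi.sub_apply, Pi.smul_apply, smul_eq_mul] at h
    simp only [Pi.sub_apply, Pi.smul_apply, dressedAnnihilate_create₂, ih, map_smul, smul_eq_mul]
    linear_combination (1 - q ^ 2) * pow_mul_RVec q i (j + 1) k a b c
      - (1 - q ^ (2 * j + 2)) * h

/-- The 3d R matrix is symmetric with respect to the weight `(q²;q²)_m`. -/
lemma poch_mul_R3_symm (hq0 : q ≠ 0) (hq : ∀ n : ℕ, 1 - q ^ (n + 1) ≠ 0) (a b c i j k : ℕ) :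
    poch (q ^ 2) (q ^ 2) a * poch (q ^ 2) (q ^ 2) b * poch (q ^ 2) (q ^ 2) c * R3 q a b c i j k =
      poch (q ^ 2) (q ^ 2) i * poch (q ^ 2) (q ^ 2) j * poch (q ^ 2) (q ^ 2) k *
        R3 q i j k a b c := by
  induction b generalizing a c i j k with
  | zero =>
    rw [R3_zero_snd hq, R3_zero_fifth hq0 hq, poch_zero_s2]
    by_cases h : a = i + j ∧ c = j + k
    · have hi := poch_sq_ne_zero hq i
      have hj := poch_sq_ne_zero hq j
      have hk := poch_sq_ne_zero hq k
      rw [if_pos h, if_pos (by omega)]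
      field_simp
    · rw [if_neg h, if_neg (by omega)]
      ring
  | succ b ih =>
    refine mul_left_cancel₀ (pow_ne_zero (a + c + 1) hq0) ?_
    have hD := R3_fifth_succ hq0 hq i j k a b c
    have h1 := ih (a + 1) (c + 1) i j k
    simp only [poch_sq_succ q] at h1 ⊢
    rcases j with _ | j
    · have hA := congrFun (congrFun (congrFun (dressedAnnihilate_RVec_zero hq0 hq i k) a) b) c
      simp only [dressedAnnihilate_apply, RVec, Pi.zero_apply] at hA
      rw [shiftRight_zero] at hD
      linear_combination h1 - poch (q ^ 2) (q ^ 2) i * poch (q ^ 2) (q ^ 2) 0 *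
        poch (q ^ 2) (q ^ 2) k * hD - poch (q ^ 2) (q ^ 2) a * poch (q ^ 2) (q ^ 2) b *
        poch (q ^ 2) (q ^ 2) c * hA
    · have hA := congrFun (congrFun (congrFun (dressedAnnihilate_RVec_succ hq0 hq i j k) a) b) c
      simp only [dressedAnnihilate_apply, RVec, Pi.smul_apply, smul_eq_mul] at hA
      have h2 := ih a c i j k
      rw [shiftRight_succ] at hD
      simp only [poch_sq_succ q] at h1 ⊢
      linear_combination h1 - poch (q ^ 2) (q ^ 2) i * (poch (q ^ 2) (q ^ 2) j *
        (1 - q ^ (2 * j + 2))) * poch (q ^ 2) (q ^ 2) k * hD - poch (q ^ 2) (q ^ 2) a *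
        poch (q ^ 2) (q ^ 2) b * poch (q ^ 2) (q ^ 2) c * hA - (1 - q ^ (2 * j + 2)) * h2

end Intertwining

section ProductVectors

variable {K : Type} [Field K] {q : K}

/-- The product vector with components `f a * g b * h c`. -/
def productVec (f g h : ℕ → K) : ℕ → ℕ → ℕ → K := fun a b c => f a * g b * h c

/-- The operator `k` on a single site. -/
def scalePow (q : K) (f : ℕ → K) : ℕ → K := fun n => q ^ n * f n

/-- The annihilation operator `a⁻` on a single site. -/
def lower (q : K) (f : ℕ → K) : ℕ → K := fun n => (1 - q ^ (2 * n + 2)) * f (n + 1)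

lemma productVec_apply (f g h : ℕ → K) (a b c : ℕ) :
    productVec f g h a b c = f a * g b * h c := rfl

lemma scalePow_apply (q : K) (f : ℕ → K) (n : ℕ) : scalePow q f n = q ^ n * f n := rfl

lemma lower_apply (q : K) (f : ℕ → K) (n : ℕ) :
    lower q f n = (1 - q ^ (2 * n + 2)) * f (n + 1) := rfl

lemma mul_shiftRight_scalePow (q : K) (f : ℕ → K) (n : ℕ) :
    q * shiftRight (scalePow q f) n = q ^ n * shiftRight f n := by
  cases n <;> simp [scalePow]
  ring

lemma dressedCreate_productVec (q : K) (f g h : ℕ → K) :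
    dressedCreate q (productVec f g h) = productVec (shiftRight f) g (shiftRight h)
      - q • productVec (scalePow q f) (shiftRight g) (scalePow q h) := by
  funext a b c
  cases a <;> cases b <;> cases c <;>
    simp [dressedCreate_apply, productVec_apply, scalePow] <;> ring

lemma dressedHop_productVec (q : K) (f g h : ℕ → K) :
    dressedHop q (productVec f g h) = productVec (shiftRight f) g (scalePow q h)
      + productVec (scalePow q f) (shiftRight g) (lower q h) := by
  funext a b c
  cases a <;> cases b <;>
    simp [dressedHop_apply, productVec_apply, scalePow, lower] <;> ring

lemma dressedCreate_add_dressedHop_productVec {x y : K} {f g h : ℕ → K}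
    (hf : ∀ n, (1 - q ^ n) * f n = x * shiftRight f n)
    (hg : ∀ n, (1 - q ^ n) * g n = x * y * shiftRight g n)
    (hh : ∀ n, (1 - q ^ n) * h n = y * shiftRight h n) (a b c : ℕ) :
    x * y * dressedCreate q (productVec f g h) a b c + x * dressedHop q (productVec f g h) a b c =
      (1 - q ^ a * q ^ b) * productVec f g h a b c := by
  have hh' := hh (c + 1)
  rw [shiftRight_succ] at hh'
  simp only [dressedCreate_productVec, dressedHop_productVec, Pi.sub_apply, Pi.add_apply,
    Pi.smul_apply, smul_eq_mul, productVec_apply, scalePow, lower]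
  linear_combination -(y * shiftRight h c * g b + q ^ c * g b * h c) * hf a
    - (1 - q ^ a) * f a * g b * hh c - q ^ a * f a * h c * hg b
    + x * q ^ a * (1 + q ^ (c + 1)) * f a * shiftRight g b * hh'

lemma dressedCreate_sq_add_dressedHop_sq_productVec {x y : K} {f g h : ℕ → K}
    (hf : ∀ n, (1 - q ^ (2 * n)) * f n = x * shiftRight (shiftRight f) n)
    (hg : ∀ n, (1 - q ^ (2 * n)) * g n = x * y * shiftRight (shiftRight g) n)
    (hh : ∀ n, (1 - q ^ (2 * n)) * h n = y * shiftRight (shiftRight h) n) (a b c : ℕ) :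
    x * y * dressedCreate q (dressedCreate q (productVec f g h)) a b c
      + x * dressedHop q (dressedHop q (productVec f g h)) a b c =
      (1 - q ^ (2 * a) * q ^ (2 * b)) * productVec f g h a b c := by
  have hlow (n : ℕ) : (1 - q ^ (2 * n + 2)) * h (n + 1) = y * shiftRight h n := hh (n + 1)
  have hlow₁ := hlow c
  have hlow₂ := hlow (c + 1)
  rw [shiftRight_succ] at hlow₂
  have hs := mul_shiftRight_scalePow q h c
  simp only [dressedCreate_productVec, dressedHop_productVec, map_sub, map_add, map_smul,
    Pi.sub_apply, Pi.add_apply, Pi.smul_apply, smul_eq_mul, productVec_apply, scalePow_apply,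
    lower_apply]
  linear_combination -(y * shiftRight (shiftRight h) c * g b + q ^ (2 * c) * g b * h c) * hf a
    - (1 - q ^ (2 * a)) * f a * g b * hh c - q ^ (2 * a) * f a * h c * hg b
    + x * q ^ (2 * a) * (1 - q ^ (2 * c + 2)) * f a * shiftRight (shiftRight g) b * hlow₂
    - x * y * shiftRight (scalePow q f) a * shiftRight g b * hs
    + x * q ^ a * q ^ (c + 1) * shiftRight f a * shiftRight g b * hlow₁
    + x * q ^ c * shiftRight (scalePow q f) a * shiftRight g b * hlow₁

end ProductVectors

section BoxSums

variable {K V W : Type} [Field K] [AddCommGroup V] [Module K V] [AddCommGroup W] [Module K W]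

lemma sum_shiftRight_smul (f : ℕ → K) (u : ℕ → V) (N : ℕ) (hu : u N = 0) :
    ∑ n ∈ range N, shiftRight f n • u n = ∑ n ∈ range N, f n • u (n + 1) := by
  cases N with
  | zero => simp
  | succ N => rw [sum_range_succ', sum_range_succ, hu]; simp

/-- The truncation of `∑ f i g j h k Φ i j k` to indices less than `N`. -/
def boxSum (N : ℕ) (f g h : ℕ → K) (Φ : ℕ → ℕ → ℕ → V) : V :=
  ∑ i ∈ range N, ∑ j ∈ range N, ∑ k ∈ range N, (f i * g j * h k) • Φ i j k

lemma map_boxSum (L : V →ₗ[K] W) (N : ℕ) (f g h : ℕ → K) (Φ : ℕ → ℕ → ℕ → V) :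
    L (boxSum N f g h Φ) = boxSum N f g h fun i j k => L (Φ i j k) := by
  simp [boxSum, map_sum]

lemma boxSum_apply (N : ℕ) (f g h : ℕ → K) (Φ : ℕ → ℕ → ℕ → ℕ → ℕ → ℕ → K) (a b c : ℕ) :
    boxSum N f g h Φ a b c = boxSum N f g h fun i j k => Φ i j k a b c := by
  simp [boxSum, Finset.sum_apply]

lemma boxSum_shiftRight_fst (N : ℕ) (f g h : ℕ → K) (Φ : ℕ → ℕ → ℕ → V)
    (hΦ : ∀ j k, Φ N j k = 0) :
    boxSum N (shiftRight f) g h Φ = boxSum N f g h fun i => Φ (i + 1) := by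
  have := sum_shiftRight_smul f
    (fun i => ∑ j ∈ range N, ∑ k ∈ range N, (g j * h k) • Φ i j k) N (by simp [hΦ])
  simpa only [boxSum, smul_sum, smul_smul, ← mul_assoc] using this

lemma boxSum_shiftRight_snd (N : ℕ) (f g h : ℕ → K) (Φ : ℕ → ℕ → ℕ → V)
    (hΦ : ∀ i k, Φ i N k = 0) :
    boxSum N f (shiftRight g) h Φ = boxSum N f g h fun i j => Φ i (j + 1) := by
  refine sum_congr rfl fun i _ => ?_
  have := sum_shiftRight_smul g (fun j => ∑ k ∈ range N, (f i * h k) • Φ i j k) N (by simp [hΦ])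
  simp only [smul_sum, smul_smul, mul_left_comm _ (f i), ← mul_assoc] at this
  exact this

lemma boxSum_one_sub_mul {e f f' g g' : ℕ → K} {x z : K}
    (hf : ∀ n, (1 - e n) * f n = x * f' n) (hg : ∀ n, (1 - e n) * g n = z * g' n)
    (N : ℕ) (h : ℕ → K) (Φ : ℕ → ℕ → ℕ → K) :
    boxSum N f g h (fun i j k => (1 - e i * e j) * Φ i j k) =
      z * boxSum N f g' h Φ + x * boxSum N f' g h (fun i j k => e j * Φ i j k) := by
  simp only [boxSum, mul_sum, ← sum_add_distrib, smul_eq_mul]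
  refine sum_congr rfl fun i _ => sum_congr rfl fun j _ => sum_congr rfl fun k _ => ?_
  linear_combination e j * g j * h k * Φ i j k * hf i + f i * h k * Φ i j k * hg j

end BoxSums

section FixedVectors

variable {K : Type} [Field K] {q : K}

lemma dressedCreate_congr {n N : ℕ} {ψ φ : ℕ → ℕ → ℕ → K}
    (hψ : ∀ a b c, a + b < n → a + b + c < N → ψ a b c = φ a b c) (a b c : ℕ)
    (hn : a + b < n + 1) (hN : a + b + c < N) :
    dressedCreate q ψ a b c = dressedCreate q φ a b c := by
  rcases a with _ | a <;> rcases b with _ | b <;> rcases c with _ | c <;>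
    simp only [dressedCreate_apply, shiftRight_zero, shiftRight_succ] <;>
    (repeat rw [hψ _ _ _ (by omega) (by omega)])

lemma dressedHop_congr {n N : ℕ} {ψ φ : ℕ → ℕ → ℕ → K}
    (hψ : ∀ a b c, a + b < n → a + b + c < N → ψ a b c = φ a b c) (a b c : ℕ)
    (hn : a + b < n + 1) (hN : a + b + c < N) :
    dressedHop q ψ a b c = dressedHop q φ a b c := by
  rcases a with _ | a <;> rcases b with _ | b <;>
    simp only [dressedHop_apply, shiftRight_zero, shiftRight_succ] <;>
    (repeat rw [hψ _ _ _ (by omega) (by omega)])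

lemma RVec_eq_zero_of_lt {i j k a b c : ℕ} (h : a + b < i + j) : RVec q i j k a b c = 0 :=
  R3_of_not (by omega)

lemma boxSum_RVec_zero_zero (hq : ∀ n : ℕ, 1 - q ^ (n + 1) ≠ 0) {N c : ℕ} (hc : c < N)
    (f g h : ℕ → K) :
    boxSum N f g h (RVec q) 0 0 c = productVec f g h 0 0 c := by
  rw [boxSum_apply, boxSum, sum_eq_single_of_mem 0 (mem_range.2 (by omega)),
    sum_eq_single_of_mem 0 (mem_range.2 (by omega)), sum_eq_single_of_mem c (mem_range.2 hc)]
  · simp [RVec, R3_zero_snd hq, productVec_apply]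
  · intro k _ hk
    simp [RVec, R3_zero_snd hq, hk.symm]
  · intro j _ hj
    refine sum_eq_zero fun k _ => ?_
    rw [RVec_eq_zero_of_lt (by omega), smul_zero]
  · intro i _ hi
    refine sum_eq_zero fun j _ => sum_eq_zero fun k _ => ?_
    rw [RVec_eq_zero_of_lt (by omega), smul_zero]

lemma one_sub_mul_boxSum_RVec (f g h : ℕ → K) {e : ℕ → K} (he : ∀ m n, e m * e n = e (m + n))
    (N a b c : ℕ) :
    (1 - e a * e b) * boxSum N f g h (RVec q) a b c =
      boxSum N f g h fun i j k => (1 - e i * e j) * RVec q i j k a b c := by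
  rw [boxSum_apply]
  simp only [boxSum, mul_sum, smul_eq_mul]
  refine sum_congr rfl fun i _ => sum_congr rfl fun j _ => sum_congr rfl fun k _ => ?_
  by_cases hab : a + b = i + j
  · rw [he, he, hab]
    ring
  · rw [RVec, R3_of_not (by omega)]
    ring

/-- A vector obeying `e w = T w`, where `T` raises the degree in the first two sites,
is determined by its components `w 0 0 c`. -/
lemma eq_of_degree_recursion {e : ℕ → ℕ → K} (he : ∀ a b, a + b ≠ 0 → e a b ≠ 0)
    {T : (ℕ → ℕ → ℕ → K) → (ℕ → ℕ → ℕ → K)} {N : ℕ}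
    (hT : ∀ (n : ℕ) (ψ φ : ℕ → ℕ → ℕ → K),
      (∀ a b c, a + b < n → a + b + c < N → ψ a b c = φ a b c) →
      ∀ a b c, a + b < n + 1 → a + b + c < N → T ψ a b c = T φ a b c)
    {ψ φ : ℕ → ℕ → ℕ → K}
    (hψ : ∀ a b c, a + b + c < N → e a b * ψ a b c = T ψ a b c)
    (hφ : ∀ a b c, a + b + c < N → e a b * φ a b c = T φ a b c)
    (h0 : ∀ c, c < N → ψ 0 0 c = φ 0 0 c) (a b c : ℕ) (hN : a + b + c < N) :
    ψ a b c = φ a b c := by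
  suffices H : ∀ n a b c, a + b < n → a + b + c < N → ψ a b c = φ a b c from
    H (a + b + 1) a b c (by omega) hN
  intro n
  induction n with
  | zero => intro a b c h; omega
  | succ n ih =>
    intro a b c hn hN
    by_cases hab : a + b = 0
    · obtain ⟨rfl, rfl⟩ : a = 0 ∧ b = 0 := by omega
      exact h0 c (by omega)
    · refine mul_left_cancel₀ (he a b hab) ?_
      rw [hψ a b c hN, hφ a b c hN, hT n ψ φ ih a b c hn hN]

/-- Product vectors with the one-step recursion of `χ₁` are fixed by the 3d R matrix. -/
lemma boxSum_RVec_of_one_step {x y : K} {f g h : ℕ → K} (hq0 : q ≠ 0)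
    (hq : ∀ n : ℕ, 1 - q ^ (n + 1) ≠ 0)
    (hf : ∀ n, (1 - q ^ n) * f n = x * shiftRight f n)
    (hg : ∀ n, (1 - q ^ n) * g n = x * y * shiftRight g n)
    (hh : ∀ n, (1 - q ^ n) * h n = y * shiftRight h n) {N a b c : ℕ} (hN : a + b + c < N) :
    boxSum N f g h (RVec q) a b c = productVec f g h a b c := by
  refine eq_of_degree_recursion (e := fun a b => 1 - q ^ a * q ^ b)
    (T := fun ψ a b c => x * y * dressedCreate q ψ a b c + x * dressedHop q ψ a b c)
    (N := N) (fun a b hab => ?_) (fun n ψ φ hψ a b c hn hN => ?_) (fun a b c hN => ?_)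
    (fun a b c _ => (dressedCreate_add_dressedHop_productVec hf hg hh a b c).symm)
    (fun c hc => boxSum_RVec_zero_zero hq hc f g h) a b c hN
  · obtain ⟨n, hn⟩ := Nat.exists_eq_succ_of_ne_zero hab
    rw [← pow_add, hn]
    exact hq n
  · rw [dressedCreate_congr hψ a b c hn hN, dressedHop_congr hψ a b c hn hN]
  · rw [one_sub_mul_boxSum_RVec f g h (fun m n => (pow_add q m n).symm),
      boxSum_one_sub_mul hf hg,
      boxSum_shiftRight_fst _ _ _ _ _ (fun j k => by rw [RVec_eq_zero_of_lt (by omega), mul_zero]),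
      boxSum_shiftRight_snd _ _ _ _ _ (fun i k => RVec_eq_zero_of_lt (by omega))]
    simp only [map_boxSum, boxSum_apply, dressedHop_RVec hq0 hq, ← RVec_succ_snd hq0 hq,
      Pi.smul_apply, smul_eq_mul]

/-- Product vectors with the two-step recursion of `χ₂` are fixed by the 3d R matrix. -/
lemma boxSum_RVec_of_two_step {x y : K} {f g h : ℕ → K} (hq0 : q ≠ 0)
    (hq : ∀ n : ℕ, 1 - q ^ (n + 1) ≠ 0)
    (hf : ∀ n, (1 - q ^ (2 * n)) * f n = x * shiftRight (shiftRight f) n)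
    (hg : ∀ n, (1 - q ^ (2 * n)) * g n = x * y * shiftRight (shiftRight g) n)
    (hh : ∀ n, (1 - q ^ (2 * n)) * h n = y * shiftRight (shiftRight h) n)
    {N a b c : ℕ} (hN : a + b + c < N) :
    boxSum N f g h (RVec q) a b c = productVec f g h a b c := by
  refine eq_of_degree_recursion (e := fun a b => 1 - q ^ (2 * a) * q ^ (2 * b))
    (T := fun ψ a b c => x * y * dressedCreate q (dressedCreate q ψ) a b c
      + x * dressedHop q (dressedHop q ψ) a b c)
    (N := N) (fun a b hab => ?_) (fun n ψ φ hψ a b c hn hN => ?_) (fun a b c hN => ?_)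
    (fun a b c _ => (dressedCreate_sq_add_dressedHop_sq_productVec hf hg hh a b c).symm)
    (fun c hc => boxSum_RVec_zero_zero hq hc f g h) a b c hN
  · obtain ⟨n, hn⟩ := Nat.exists_eq_succ_of_ne_zero hab
    rw [← pow_add, ← mul_add, hn, pow_mul]
    exact one_sub_sq_pow_ne_zero hq n
  · rw [dressedCreate_congr (dressedCreate_congr hψ) a b c (by omega) hN,
      dressedHop_congr (dressedHop_congr hψ) a b c (by omega) hN]
  · rw [one_sub_mul_boxSum_RVec f g h (e := fun n => q ^ (2 * n))
        (fun m n => by rw [mul_add, pow_add]),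
      boxSum_one_sub_mul (e := fun n => q ^ (2 * n)) hf hg,
      boxSum_shiftRight_fst _ _ _ _ _ (fun j k => by rw [RVec_eq_zero_of_lt (by omega), mul_zero]),
      boxSum_shiftRight_fst _ _ _ _ _ (fun j k => by rw [RVec_eq_zero_of_lt (by omega), mul_zero]),
      boxSum_shiftRight_snd _ _ _ _ _ (fun i k => RVec_eq_zero_of_lt (by omega)),
      boxSum_shiftRight_snd _ _ _ _ _ (fun i k => RVec_eq_zero_of_lt (by omega))]
    simp only [map_boxSum, boxSum_apply, dressedHop_RVec hq0 hq, ← RVec_succ_snd hq0 hq, map_smul,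
      Pi.smul_apply, smul_eq_mul, two_mul, pow_add, mul_assoc]

lemma one_sub_mul_chi1 (hq : ∀ n : ℕ, 1 - q ^ (n + 1) ≠ 0) (z : K) (n : ℕ) :
    (1 - q ^ n) * chi1 q z n = z * shiftRight (chi1 q z) n := by
  cases n with
  | zero => simp
  | succ n =>
    have := poch_self_ne_zero hq n
    have := hq n
    rw [shiftRight_succ, chi1, chi1, poch_self_succ]
    field_simp
    ring

lemma one_sub_mul_chi2 (hq : ∀ n : ℕ, 1 - q ^ (n + 1) ≠ 0) (z : K) (n : ℕ) :
    (1 - q ^ (2 * n)) * chi2 q z n = z * shiftRight (shiftRight (chi2 q z)) n := by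
  rcases n with _ | _ | n
  · simp
  · simp [chi2]
  · rw [shiftRight_succ, shiftRight_succ, chi2, chi2, show n + 1 + 1 = n + 2 from rfl,
      Nat.add_mod_right, Nat.add_div_right n two_pos]
    split_ifs with h
    · obtain ⟨m, rfl⟩ := Nat.dvd_of_mod_eq_zero h
      rw [Nat.mul_div_cancel_left m two_pos, poch_self_succ]
      have hq4 (n : ℕ) : 1 - (q ^ 4) ^ (n + 1) ≠ 0 := by
        rw [← pow_mul]
        exact hq (4 * n + 3)
      have := poch_self_ne_zero hq4 m
      have := hq4 m
      rw [show 2 * (2 * m + 2) = 4 * (m + 1) by ring, pow_mul]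
      field_simp
      ring
    · simp

/-- The support of `R3 q a b c` lies in a box. -/
lemma support_R3_mul_subset (a b c : ℕ) (u : ℕ × ℕ × ℕ → K) :
    (Function.support fun v : ℕ × ℕ × ℕ => R3 q a b c v.1 v.2.1 v.2.2 * u v) ⊆
      (range (a + b + c + 1) ×ˢ range (a + b + c + 1) ×ˢ range (a + b + c + 1) :
        Finset (ℕ × ℕ × ℕ)) := by
  rintro ⟨i, j, k⟩ hv
  by_contra hmem
  refine hv ?_
  simp only
  rw [R3_of_not, zero_mul]
  simp only [coe_product, Set.mem_prod, coe_range, Set.mem_Iio] at hmem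
  omega

lemma finsum_R3_mul_eq_boxSum (f g h : ℕ → K) (a b c : ℕ) :
    ∑ᶠ v : ℕ × ℕ × ℕ, R3 q a b c v.1 v.2.1 v.2.2 * (f v.1 * g v.2.1 * h v.2.2) =
      boxSum (a + b + c + 1) f g h (RVec q) a b c := by
  rw [finsum_eq_sum_of_support_subset _ (support_R3_mul_subset a b c _), sum_product, boxSum_apply]
  refine sum_congr rfl fun i _ => ?_
  rw [sum_product]
  refine sum_congr rfl fun j _ => sum_congr rfl fun k _ => ?_
  rw [smul_eq_mul, mul_comm]
  rfl

end FixedVectors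

theorem boundary_vectors_fixed_by_R3
    (χ : RatFunc ℚ → ℕ → RatFunc ℚ)
    (hχ : χ = chi1 (RatFunc.X : RatFunc ℚ) ∨ χ = chi2 (RatFunc.X : RatFunc ℚ))
    (x y : RatFunc ℚ) :
    (∀ a b c : ℕ,
      (∑ᶠ v : ℕ × ℕ × ℕ,
        R3 (RatFunc.X : RatFunc ℚ) a b c v.1 v.2.1 v.2.2 *
          (χ x v.1 * χ (x * y) v.2.1 * χ y v.2.2)) =
      χ x a * χ (x * y) b * χ y c) ∧
    (∀ i j k : ℕ,
      (∑ᶠ v : ℕ × ℕ × ℕ,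
        poch ((RatFunc.X : RatFunc ℚ) ^ 2) (RatFunc.X ^ 2) v.1 *
          poch ((RatFunc.X : RatFunc ℚ) ^ 2) (RatFunc.X ^ 2) v.2.1 *
          poch ((RatFunc.X : RatFunc ℚ) ^ 2) (RatFunc.X ^ 2) v.2.2 *
          (χ x v.1 * χ (x * y) v.2.1 * χ y v.2.2) *
          R3 (RatFunc.X : RatFunc ℚ) v.1 v.2.1 v.2.2 i j k) =
      poch ((RatFunc.X : RatFunc ℚ) ^ 2) (RatFunc.X ^ 2) i *
        poch ((RatFunc.X : RatFunc ℚ) ^ 2) (RatFunc.X ^ 2) j *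
        poch ((RatFunc.X : RatFunc ℚ) ^ 2) (RatFunc.X ^ 2) k *
        (χ x i * χ (x * y) j * χ y k)) := by
  have hX (n : ℕ) : (1 : RatFunc ℚ) - RatFunc.X ^ (n + 1) ≠ 0 := by
    intro h
    have h1 : (Polynomial.X : Polynomial ℚ) ^ (n + 1) = 1 := by
      apply RatFunc.algebraMap_injective ℚ
      rw [map_pow, RatFunc.algebraMap_X, map_one]
      exact (sub_eq_zero.1 h).symm
    simpa using congrArg Polynomial.natDegree h1
  have hX0 : (RatFunc.X : RatFunc ℚ) ≠ 0 := RatFunc.X_ne_zero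
  have hfix : ∀ a b c : ℕ,
      (∑ᶠ v : ℕ × ℕ × ℕ,
        R3 (RatFunc.X : RatFunc ℚ) a b c v.1 v.2.1 v.2.2 *
          (χ x v.1 * χ (x * y) v.2.1 * χ y v.2.2)) =
      χ x a * χ (x * y) b * χ y c := by
    intro a b c
    rw [finsum_R3_mul_eq_boxSum]
    rcases hχ with rfl | rfl
    · exact boxSum_RVec_of_one_step hX0 hX (one_sub_mul_chi1 hX x) (one_sub_mul_chi1 hX (x * y))
        (one_sub_mul_chi1 hX y) (Nat.lt_succ_self _)
    · exact boxSum_RVec_of_two_step hX0 hX (one_sub_mul_chi2 hX x) (one_sub_mul_chi2 hX (x * y))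
        (one_sub_mul_chi2 hX y) (Nat.lt_succ_self _)
  refine ⟨hfix, fun i j k => ?_⟩
  rw [← hfix i j k, mul_finsum]
  refine finsum_congr fun v => ?_
  linear_combination (χ x v.1 * χ (x * y) v.2.1 * χ y v.2.2) *
    poch_mul_R3_symm hX0 hX v.1 v.2.1 v.2.2 i j k
end
end

section
/- The six operators e_0, e_1, f_0, f_1, k_0^{±1}, k_1^{±1} on F defined in the context satisfy all defining relations of U_q(A_1^{(1)}) with Cartan matrix (a_{ij}) = [[2,−2],[−2,2]] and q_0 = q_1 = q, namely: k_i k_i^{−1} = k_i^{−1} k_i = 1; k_0 k_1 = k_1 k_0; k_i e_j k_i^{−1} = q^{a_{ij}} e_j and k_i f_j k_i^{−1} = q^{−a_{ij}} f_j for all i,j ∈ {0,1}; [e_i, f_j] = δ_{ij} (k_i − k_i^{−1})/(q − q^{−1}); and the Serre relations Σ_{ν=0}^{3} (−1)^ν e_i^{(3−ν)} e_j e_i^{(ν)} = 0 and Σ_{ν=0}^{3} (−1)^ν f_i^{(3−ν)} f_j f_i^{(ν)} = 0 for i ≠ j, where g^{(ν)} = g^ν/[ν]_q!, [ν]_q!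 = ∏_{l=1}^ν [l]. -/
/- The Verma-type module V_x(α): the operators satisfy the defining relations of U_q(A_1^{(1)}). -/

noncomputable section
open Finset

/-- The operator on `F = ⊕_{m≥0} K|m⟩ = ℕ →₀ K` sending the basis vector `|m⟩` to `v m`. -/
def opOf {K : Type} [Field K] (v : ℕ → (ℕ →₀ K)) : Module.End K (ℕ →₀ K) :=
  Finsupp.lsum K fun m => LinearMap.toSpanSingleton K (ℕ →₀ K) (v m)

/-- `[m] = (q^m - q^{-m})/(q - q^{-1})`. -/
def qint {K : Type} [Field K] (q : K) (m : ℤ) : K := (q ^ m - q ^ (-m)) / (q - q⁻¹)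

/-- `{u} = (u - u^{-1})/(q - q^{-1})`. -/
def brace {K : Type} [Field K] (q u : K) : K := (u - u⁻¹) / (q - q⁻¹)

/-- `[n]_q! = ∏_{l=1}^n [l]_q`. -/
def qfac {K : Type} [Field K] (q : K) (n : ℕ) : K := ∏ l ∈ Icc 1 n, qint q (l : ℤ)

/-- `e₁|m⟩ = -[m]{α q^{m-1}}|m-1⟩`. -/
def e1V {K : Type} [Field K] (q α : K) : Module.End K (ℕ →₀ K) :=
  opOf fun m => Finsupp.single (m - 1) (-(qint q (m : ℤ) * brace q (α * q ^ ((m : ℤ) - 1))))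

/-- `f₁|m⟩ = |m+1⟩`. -/
def f1V {K : Type} [Field K] : Module.End K (ℕ →₀ K) :=
  opOf fun m => Finsupp.single (m + 1) (1 : K)

/-- `k₁|m⟩ = α⁻¹ q^{-2m}|m⟩`. -/
def k1V {K : Type} [Field K] (q α : K) : Module.End K (ℕ →₀ K) :=
  opOf fun m => Finsupp.single m (α⁻¹ * q ^ (-(2 * (m : ℤ))))

/-- `k₁⁻¹|m⟩ = α q^{2m}|m⟩`. -/
def k1Vinv {K : Type} [Field K] (q α : K) : Module.End K (ℕ →₀ K) :=
  opOf fun m => Finsupp.single m (α * q ^ (2 * (m : ℤ)))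
section Operators

variable {K : Type} [Field K]

@[simp]
theorem opOf_single (v : ℕ → (ℕ →₀ K)) (m : ℕ) (c : K) :
    opOf v (Finsupp.single m c) = c • v m := by
  simp [opOf]

theorem end_ext {A B : Module.End K (ℕ →₀ K)}
    (h : ∀ m, A (Finsupp.single m 1) = B (Finsupp.single m 1)) : A = B :=
  Finsupp.lhom_ext' fun m => LinearMap.ext_ring (h m)

/-- The weighted lowering operator `|m⟩ ↦ c m |m-1⟩`. -/
def lowering (c : ℕ → K) : Module.End K (ℕ →₀ K) :=
  opOf fun m => Finsupp.single (m - 1) (c m)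

theorem lowering_basis (c : ℕ → K) (m : ℕ) :
    lowering c (Finsupp.single m 1) = c m • Finsupp.single (m - 1) 1 := by
  rw [lowering, opOf_single, one_smul, Finsupp.smul_single_one]

theorem f1V_basis (m : ℕ) :
    f1V (Finsupp.single m (1 : K)) = Finsupp.single (m + 1) 1 := by
  rw [f1V, opOf_single, one_smul]

theorem k1V_basis (q α : K) (m : ℕ) :
    k1V q α (Finsupp.single m 1) = (α⁻¹ * q ^ (-(2 * (m : ℤ)))) • Finsupp.single m 1 := by
  rw [k1V, opOf_single, one_smul, Finsupp.smul_single_one]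

theorem k1Vinv_basis (q α : K) (m : ℕ) :
    k1Vinv q α (Finsupp.single m 1) = (α * q ^ (2 * (m : ℤ))) • Finsupp.single m 1 := by
  rw [k1Vinv, opOf_single, one_smul, Finsupp.smul_single_one]

theorem raising_lowering_serre {c : ℕ → K} {t : K} (h0 : c 0 = 0)
    (hc : ∀ m, c (m + 3) - t * c (m + 2) + t * c (m + 1) - c m = 0) :
    f1V ^ 3 * lowering c - t • (f1V ^ 2 * lowering c * f1V)
      + t • (f1V * lowering c * f1V ^ 2) - lowering c * f1V ^ 3 = 0 := by
  refine end_ext fun m => ?_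
  have h := hc m
  rcases m with _ | m
  all_goals
    simp only [pow_succ, pow_zero, one_mul, Module.End.mul_apply, LinearMap.sub_apply,
      LinearMap.add_apply, LinearMap.smul_apply, LinearMap.zero_apply, map_smul, lowering_basis,
      f1V_basis, Nat.add_sub_cancel, h0, zero_smul, zero_add, map_zero] at h ⊢
    match_scalars
    linear_combination -h

theorem lowering_raising_serre {c : ℕ → K} {t : K} (h0 : c 0 = 0)
    (hc : ∀ m, c (m + 3) - t * c (m + 2) + t * c (m + 1) - c m = 0) :
    lowering c ^ 3 * f1V - t • (lowering c ^ 2 * f1V * lowering c)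
      + t • (lowering c * f1V * lowering c ^ 2) - f1V * lowering c ^ 3 = 0 := by
  refine end_ext fun m => ?_
  have h := hc (m - 2)
  rcases m with _ | _ | _ | m
  all_goals
    simp only [pow_succ, pow_zero, one_mul, Module.End.mul_apply, LinearMap.sub_apply,
      LinearMap.add_apply, LinearMap.smul_apply, LinearMap.zero_apply, map_smul, lowering_basis,
      f1V_basis, Nat.add_sub_cancel, Nat.reduceSubDiff, h0, zero_smul, smul_zero, zero_add,
      add_zero, sub_zero, map_zero] at h ⊢
  · match_scalars
    linear_combination (c 2 * c 1) * h
  · match_scalars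
    linear_combination (c (m + 3) * c (m + 2)) * h

end Operators

section Scalars

variable {K : Type} [Field K]

theorem qint_zero (q : K) : qint q 0 = 0 := by simp [qint]

theorem qint_one {q : K} (hd : q - q⁻¹ ≠ 0) : qint q 1 = 1 := by simp [qint, hd]

/-- The coefficient of `e₁` at `|m⟩`. -/
def e1Coeff (q α : K) (m : ℕ) : K :=
  -(qint q (m : ℤ) * brace q (α * q ^ ((m : ℤ) - 1)))

theorem e1V_eq_lowering (q α : K) : e1V q α = lowering (e1Coeff q α) := rfl

theorem e1Coeff_zero (q α : K) : e1Coeff q α 0 = 0 := by simp [e1Coeff, qint_zero]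

theorem sub_inv_ne_zero_of_sq {q : K} (hq0 : q ≠ 0) (h2 : q ^ 2 ≠ 1) : q - q⁻¹ ≠ 0 := by
  intro h
  apply h2
  field_simp at h
  linear_combination h

theorem e1Coeff_closed {q α : K} (hq0 : q ≠ 0) (hα : α ≠ 0) (m : ℕ) :
    e1Coeff q α m = -(α * q⁻¹ * (q ^ m) ^ 2 - α * q⁻¹ - α⁻¹ * q
      + α⁻¹ * q * ((q ^ m)⁻¹) ^ 2) / (q - q⁻¹) ^ 2 := by
  have hp : q ^ m ≠ 0 := pow_ne_zero _ hq0
  simp only [e1Coeff, qint, brace, zpow_neg, zpow_sub₀ hq0, zpow_natCast, zpow_one]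
  rw [div_mul_div_comm, ← neg_div, ← sq]
  congr 1
  generalize q ^ m = p at hp
  field_simp
  ring

theorem e1Coeff_commutator {q α : K} (hq0 : q ≠ 0) (h2 : q ^ 2 ≠ 1) (hα : α ≠ 0) (m : ℕ) :
    e1Coeff q α (m + 1) - e1Coeff q α m =
      (q - q⁻¹)⁻¹ * (α⁻¹ * q ^ (-(2 * (m : ℤ))) - α * q ^ (2 * (m : ℤ))) := by
  have hd := sub_inv_ne_zero_of_sq hq0 h2
  have hp : q ^ m ≠ 0 := pow_ne_zero _ hq0
  have h : q ^ (2 * (m : ℤ)) = (q ^ m) ^ 2 := by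
    rw [mul_comm, zpow_mul, zpow_natCast, zpow_ofNat]
  rw [e1Coeff_closed hq0 hα, e1Coeff_closed hq0 hα, zpow_neg, h, ← sub_div,
    div_eq_iff (pow_ne_zero 2 hd), pow_succ q]
  generalize q ^ m = p at hp
  rw [sq (q - q⁻¹), ← mul_assoc, mul_right_comm (q - q⁻¹)⁻¹, inv_mul_cancel₀ hd, one_mul]
  field_simp
  ring

theorem e1Coeff_recurrence {q α : K} (hq0 : q ≠ 0) (hα : α ≠ 0) (m : ℕ) :
    e1Coeff q α (m + 3) - (q ^ 2 + 1 + q⁻¹ ^ 2) * e1Coeff q α (m + 2)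
      + (q ^ 2 + 1 + q⁻¹ ^ 2) * e1Coeff q α (m + 1) - e1Coeff q α m = 0 := by
  have hp : q ^ m ≠ 0 := pow_ne_zero _ hq0
  simp only [e1Coeff_closed hq0 hα, mul_div_assoc', ← sub_div, ← add_div]
  rw [div_eq_zero_iff]
  left
  simp only [pow_add]
  generalize q ^ m = p at hp
  field_simp
  ring

theorem qint_three {q : K} (hq0 : q ≠ 0) (h2 : q ^ 2 ≠ 1) :
    qint q 3 = q ^ 2 + 1 + q⁻¹ ^ 2 := by
  have hd := sub_inv_ne_zero_of_sq hq0 h2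
  rw [qint, div_eq_iff hd, zpow_neg, zpow_ofNat]
  field_simp
  ring

theorem qint_three_ne_zero {q : K} (hq0 : q ≠ 0) (h2 : q ^ 2 ≠ 1) (h6 : q ^ 6 ≠ 1) :
    qint q 3 ≠ 0 := by
  rw [qint_three hq0 h2]
  intro h
  apply h6
  field_simp at h
  linear_combination (q ^ 2 - 1) * h

/-- The `q`-Serre relation with divided powers follows from the one with `q`-binomial
coefficients, and is insensitive to rescaling the generators. -/
theorem serre_sum_smul {M : Type} [AddCommGroup M] [Module K M] {q : K}
    (hq0 : q ≠ 0) (h2 : q ^ 2 ≠ 1) (h6 : q ^ 6 ≠ 1) {X Y : Module.End K M}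
    (h : X ^ 3 * Y - (q ^ 2 + 1 + q⁻¹ ^ 2) • (X ^ 2 * Y * X)
      + (q ^ 2 + 1 + q⁻¹ ^ 2) • (X * Y * X ^ 2) - Y * X ^ 3 = 0) (a b : K) :
    ∑ ν ∈ range 4, ((-1 : K) ^ ν * (qfac q (3 - ν))⁻¹ * (qfac q ν)⁻¹) •
      ((a • X) ^ (3 - ν) * (b • Y) * (a • X) ^ ν) = 0 := by
  have hd := sub_inv_ne_zero_of_sq hq0 h2
  have h3 := qint_three_ne_zero hq0 h2 h6
  have f0 : qfac q 0 = 1 := by simp [qfac]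
  have f1 : qfac q 1 = 1 := by simp [qfac, qint_one hd]
  have f2 : qfac q 2 = qint q 2 := by simp [qfac, prod_Icc_succ_top, qint_one hd]
  have f3 : qfac q 3 = qint q 2 * qint q 3 := by simp [qfac, prod_Icc_succ_top, qint_one hd]
  rw [← qint_three hq0 h2] at h
  have key : (a ^ 3 * b * (qint q 2 * qint q 3)⁻¹) •
      (X ^ 3 * Y - qint q 3 • (X ^ 2 * Y * X) + qint q 3 • (X * Y * X ^ 2) - Y * X ^ 3) = 0 := by
    rw [h, smul_zero]
  rw [← key]
  simp only [sum_range_succ, range_zero, sum_empty, zero_add, Nat.sub_zero, Nat.reduceSub,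
    f0, f1, f2, f3, smul_pow, smul_mul_assoc, mul_smul_comm, smul_smul, smul_add, smul_sub,
    pow_zero, pow_one, one_mul, mul_one, inv_one]
  have e : (qint q 2 * qint q 3)⁻¹ * qint q 3 = (qint q 2)⁻¹ := by
    rw [mul_inv, mul_assoc, inv_mul_cancel₀ h3, mul_one]
  rw [mul_assoc (a ^ 3 * b), e]
  match_scalars <;> ring

end Scalars

section Relations

variable {K : Type} [Field K]

theorem k1V_mul_k1Vinv {q α : K} (hq0 : q ≠ 0) (hα : α ≠ 0) : k1V q α * k1Vinv q α = 1 := by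
  refine end_ext fun m => ?_
  have hp : q ^ (2 * (m : ℤ)) ≠ 0 := zpow_ne_zero _ hq0
  simp only [Module.End.mul_apply, k1V_basis, k1Vinv_basis, map_smul, Module.End.one_apply, zpow_neg]
  match_scalars
  field_simp

theorem k1Vinv_mul_k1V {q α : K} (hq0 : q ≠ 0) (hα : α ≠ 0) : k1Vinv q α * k1V q α = 1 := by
  refine end_ext fun m => ?_
  have hp : q ^ (2 * (m : ℤ)) ≠ 0 := zpow_ne_zero _ hq0
  simp only [Module.End.mul_apply, k1V_basis, k1Vinv_basis, map_smul, Module.End.one_apply, zpow_neg]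
  match_scalars
  field_simp

theorem k1V_mul_f1V {q α : K} (hq0 : q ≠ 0) :
    k1V q α * f1V = q ^ (-2 : ℤ) • (f1V * k1V q α) := by
  refine end_ext fun m => ?_
  simp only [Module.End.mul_apply, LinearMap.smul_apply, map_smul, k1V_basis, f1V_basis,
    Nat.cast_add, Nat.cast_one, mul_add, neg_add, zpow_add₀ hq0, mul_one]
  match_scalars
  ring

theorem k1V_mul_lowering {q α : K} (hq0 : q ≠ 0) {c : ℕ → K} (h0 : c 0 = 0) :
    k1V q α * lowering c = q ^ (2 : ℤ) • (lowering c * k1V q α) := by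
  refine end_ext fun m => ?_
  rcases m with _ | m
  · simp only [Module.End.mul_apply, LinearMap.smul_apply, map_smul, k1V_basis, lowering_basis, h0,
      zero_smul, smul_zero, map_zero]
  · have hz : q ^ (-2 : ℤ) * q ^ (2 : ℤ) = 1 := by rw [← zpow_add₀ hq0]; simp
    simp only [Module.End.mul_apply, LinearMap.smul_apply, map_smul, k1V_basis, lowering_basis,
      Nat.cast_add, Nat.cast_one, mul_add, neg_add, zpow_add₀ hq0, mul_one, Nat.add_sub_cancel]
    match_scalars
    linear_combination (-(c (m + 1) * α⁻¹ * q ^ (-(2 * (m : ℤ))))) * hz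

theorem conj_eq_smul {M : Type} [AddCommGroup M] [Module K M] {k k' A : Module.End K M} {s : K}
    (hk : k * k' = 1) (h : k * A = s • (A * k)) : k * A * k' = s • A := by
  rw [h, smul_mul_assoc, mul_assoc, hk, mul_one]

theorem conj_inv_eq_smul {M : Type} [AddCommGroup M] [Module K M] {k k' A : Module.End K M}
    {s t : K} (hk' : k' * k = 1) (hts : t * s = 1)
    (h : k * A * k' = s • A) : k' * A * k = t • A := by
  calc k' * A * k = (t * s) • (k' * A * k) := by rw [hts, one_smul]
    _ = t • (k' * (s • A) * k) := by rw [mul_smul_comm, smul_mul_assoc, smul_smul]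
    _ = t • ((k' * k) * A * (k' * k)) := by rw [← h]; simp only [mul_assoc]
    _ = t • A := by rw [hk', one_mul, mul_one]

theorem e1V_commutator {q α : K} (hq0 : q ≠ 0) (h2 : q ^ 2 ≠ 1) (hα : α ≠ 0) :
    e1V q α * f1V - f1V * e1V q α = (q - q⁻¹)⁻¹ • (k1V q α - k1Vinv q α) := by
  refine end_ext fun m => ?_
  have h := e1Coeff_commutator hq0 h2 hα m
  rw [e1V_eq_lowering]
  rcases m with _ | m
  all_goals
    simp only [Module.End.mul_apply, LinearMap.sub_apply, LinearMap.smul_apply, map_smul,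
      lowering_basis, f1V_basis, k1V_basis, k1Vinv_basis, Nat.add_sub_cancel, e1Coeff_zero,
      Nat.cast_add, Nat.cast_one, zero_smul, zero_add, map_zero] at h ⊢
    match_scalars
    linear_combination h

end Relations

theorem Transcendental.pow_ne_one {K : Type} [Field K] [Algebra ℚ K] {q : K}
    (hq : Transcendental ℚ q) {n : ℕ} (hn : 0 < n) : q ^ n ≠ 1 := fun h =>
  hq (IsAlgebraic.of_pow hn (h ▸ isAlgebraic_one))

theorem Uq_A1_relations
    (K : Type) [Field K] [Algebra ℚ K] (q α x : K)
    (hq : Transcendental ℚ q) (hα : α ≠ 0) (hx : x ≠ 0)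
    (e₀ f₀ k₀ k₀' e₁ f₁ k₁ k₁' : Module.End K (ℕ →₀ K))
    (he₁ : e₁ = e1V q α) (hf₁ : f₁ = f1V) (hk₁ : k₁ = k1V q α) (hk₁' : k₁' = k1Vinv q α)
    (he₀ : e₀ = x • f₁) (hf₀ : f₀ = x⁻¹ • e₁) (hk₀ : k₀ = k₁') (hk₀' : k₀' = k₁) :
    (k₀ * k₀' = 1 ∧ k₀' * k₀ = 1 ∧ k₁ * k₁' = 1 ∧ k₁' * k₁ = 1 ∧ k₀ * k₁ = k₁ * k₀) ∧
    (k₀ * e₀ * k₀' = q ^ (2 : ℤ) • e₀ ∧ k₀ * e₁ * k₀' = q ^ (-2 : ℤ) • e₁ ∧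
      k₁ * e₀ * k₁' = q ^ (-2 : ℤ) • e₀ ∧ k₁ * e₁ * k₁' = q ^ (2 : ℤ) • e₁) ∧
    (k₀ * f₀ * k₀' = q ^ (-2 : ℤ) • f₀ ∧ k₀ * f₁ * k₀' = q ^ (2 : ℤ) • f₁ ∧
      k₁ * f₀ * k₁' = q ^ (2 : ℤ) • f₀ ∧ k₁ * f₁ * k₁' = q ^ (-2 : ℤ) • f₁) ∧
    (e₀ * f₀ - f₀ * e₀ = (q - q⁻¹)⁻¹ • (k₀ - k₀') ∧
      e₁ * f₁ - f₁ * e₁ = (q - q⁻¹)⁻¹ • (k₁ - k₁') ∧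
      e₀ * f₁ - f₁ * e₀ = 0 ∧ e₁ * f₀ - f₀ * e₁ = 0) ∧
    ((∑ ν ∈ range 4, ((-1 : K) ^ ν * (qfac q (3 - ν))⁻¹ * (qfac q ν)⁻¹) •
        (e₀ ^ (3 - ν) * e₁ * e₀ ^ ν)) = 0 ∧
      (∑ ν ∈ range 4, ((-1 : K) ^ ν * (qfac q (3 - ν))⁻¹ * (qfac q ν)⁻¹) •
        (e₁ ^ (3 - ν) * e₀ * e₁ ^ ν)) = 0 ∧
      (∑ ν ∈ range 4, ((-1 : K) ^ ν * (qfac q (3 - ν))⁻¹ * (qfac q ν)⁻¹) •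
        (f₀ ^ (3 - ν) * f₁ * f₀ ^ ν)) = 0 ∧
      (∑ ν ∈ range 4, ((-1 : K) ^ ν * (qfac q (3 - ν))⁻¹ * (qfac q ν)⁻¹) •
        (f₁ ^ (3 - ν) * f₀ * f₁ ^ ν)) = 0) := by
  have hq0 : q ≠ 0 := fun h => hq (h ▸ isAlgebraic_zero)
  have h2 : q ^ 2 ≠ 1 := hq.pow_ne_one (by norm_num)
  have h6 : q ^ 6 ≠ 1 := hq.pow_ne_one (by norm_num)
  have hz : q ^ (-2 : ℤ) * q ^ (2 : ℤ) = 1 := by rw [← zpow_add₀ hq0]; simp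
  have hz' : q ^ (2 : ℤ) * q ^ (-2 : ℤ) = 1 := by rw [mul_comm, hz]
  have hkk : k₁ * k₁' = 1 := by rw [hk₁, hk₁', k1V_mul_k1Vinv hq0 hα]
  have hkk' : k₁' * k₁ = 1 := by rw [hk₁, hk₁', k1Vinv_mul_k1V hq0 hα]
  have he : k₁ * e₁ * k₁' = q ^ (2 : ℤ) • e₁ := conj_eq_smul hkk (by
    rw [hk₁, he₁, e1V_eq_lowering, k1V_mul_lowering hq0 (e1Coeff_zero q α)])
  have hf : k₁ * f₁ * k₁' = q ^ (-2 : ℤ) • f₁ := conj_eq_smul hkk (by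
    rw [hk₁, hf₁, k1V_mul_f1V hq0])
  have he' := conj_inv_eq_smul hkk' hz he
  have hf' := conj_inv_eq_smul hkk' hz' hf
  have hc : e₁ * f₁ - f₁ * e₁ = (q - q⁻¹)⁻¹ • (k₁ - k₁') := by
    rw [he₁, hf₁, hk₁, hk₁', e1V_commutator hq0 h2 hα]
  have sf := serre_sum_smul hq0 h2 h6
    (raising_lowering_serre (e1Coeff_zero q α) (e1Coeff_recurrence hq0 hα))
  have se := serre_sum_smul hq0 h2 h6
    (lowering_raising_serre (e1Coeff_zero q α) (e1Coeff_recurrence hq0 hα))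
  rw [← e1V_eq_lowering, ← he₁, ← hf₁] at sf se
  subst hk₀ hk₀' he₀ hf₀
  refine ⟨⟨hkk', hkk, hkk, hkk', by rw [hkk, hkk']⟩, ⟨?_, he', ?_, he⟩, ⟨?_, hf', ?_, hf⟩,
    ⟨?_, hc, ?_, ?_⟩, ?_, ?_, ?_, ?_⟩
  · rw [mul_smul_comm, smul_mul_assoc, hf', smul_comm]
  · rw [mul_smul_comm, smul_mul_assoc, hf, smul_comm]
  · rw [mul_smul_comm, smul_mul_assoc, he', smul_comm]
  · rw [mul_smul_comm, smul_mul_assoc, he, smul_comm]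
  · rw [smul_mul_smul_comm, smul_mul_smul_comm, mul_inv_cancel₀ hx, inv_mul_cancel₀ hx, one_smul,
      one_smul, ← neg_sub (e₁ * f₁), hc]
    module
  · refine LinearMap.ext fun v => ?_
    rw [smul_mul_assoc, mul_smul_comm, LinearMap.sub_apply]
    exact sub_self _
  · refine LinearMap.ext fun v => ?_
    rw [smul_mul_assoc, mul_smul_comm, LinearMap.sub_apply]
    exact sub_self _
  · simpa only [one_smul] using sf x 1
  · simpa only [one_smul] using se 1 x
  · simpa only [one_smul] using se x⁻¹ 1
  · simpa only [one_smul] using sf 1 x⁻¹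
end
end

section
/- Over the field K = ℚ(q,α,β) of rational functions in q, α, β, the family of vectors { (Δf_1)^r v^{(d)}_{α,β} : d ≥ 0, r ≥ 0 } is a basis of F⊗F, where Δf_1 = f_1⊗1 + k_1^{−1}⊗f_1 (first tensor factor with parameter α, second with parameter β). Consequently F⊗F = ⊕_{d≥0} V^{(d)} with V^{(d)} = span{ (Δf_1)^r v^{(d)}_{α,β} : r ≥ 0 }. -/
/- Over K = ℚ(q,α,β), the vectors (Δf₁)^r v^{(d)}_{α,β} form a basis of F⊗F, giving F⊗F = ⊕_d V^{(d)}. -/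

noncomputable section
open Finset TensorProduct

/-- The vector `v^{(d)}_{α,β} = Σ_{j=0}^d (-q^{1-d}β⁻¹)^j binom(d,j)_{q²}
(∏_{k=1}^j {αq^{d-k}}/{βq^{k-1}}) |d-j⟩⊗|j⟩ ∈ F⊗F`. -/
def vvec {K : Type} [Field K] (q α β : K) (d : ℕ) : (ℕ →₀ K) ⊗[K] (ℕ →₀ K) :=
  ∑ j ∈ range (d + 1),
    ((-(q ^ (1 - (d : ℤ)) * β⁻¹)) ^ j * qbinom (q ^ 2) d j *
        ∏ k ∈ Icc 1 j, brace q (α * q ^ ((d : ℤ) - (k : ℤ))) / brace q (β * q ^ ((k : ℤ) - 1))) •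
      (Finsupp.single (d - j) (1 : K) ⊗ₜ[K] Finsupp.single j (1 : K))

/-- `Δe₁ = 1⊗e₁ + e₁⊗k₁` (first factor with parameter α, second with β). -/
def De1 {K : Type} [Field K] (q α β : K) :
    Module.End K ((ℕ →₀ K) ⊗[K] (ℕ →₀ K)) :=
  TensorProduct.map LinearMap.id (e1V q β) + TensorProduct.map (e1V q α) (k1V q β)

/-- `Δk₁ = k₁⊗k₁`. -/
def Dk1 {K : Type} [Field K] (q α β : K) :
    Module.End K ((ℕ →₀ K) ⊗[K] (ℕ →₀ K)) :=
  TensorProduct.map (k1V q α) (k1V q β)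

/-- `Δf₁ = f₁⊗1 + k₁⁻¹⊗f₁` (first factor with parameter α, second with β). -/
def Df1 {K : Type} [Field K] (q α β : K) :
    Module.End K ((ℕ →₀ K) ⊗[K] (ℕ →₀ K)) :=
  TensorProduct.map f1V LinearMap.id + TensorProduct.map (k1Vinv q α) f1V

/-- `K = ℚ(q,α,β)`. -/
abbrev K9 : Type := RatFunc (RatFunc (RatFunc ℚ))

/-- `q ∈ ℚ(q,α,β)`. -/
def q9 : K9 := RatFunc.C (RatFunc.C (RatFunc.X : RatFunc ℚ))

/-- `α ∈ ℚ(q,α,β)`. -/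
def α9 : K9 := RatFunc.C (RatFunc.X : RatFunc (RatFunc ℚ))

/-- `β ∈ ℚ(q,α,β)`. -/
def β9 : K9 := RatFunc.X

/-- If `T` is injective, `Φ` kills the range of `T` and `Φ ∘ v` is linearly independent, then the
vectors `T ^ r (v i)` are linearly independent. -/
theorem linearIndependent_pow_apply {K M N ι : Type*} [Field K] [AddCommMonoid M] [Module K M]
    [AddCommMonoid N] [Module K N] {T : Module.End K M} (hT : Function.Injective T)
    {Φ : M →ₗ[K] N} (hΦ : ∀ x, Φ (T x) = 0) {v : ι → M} (hv : LinearIndependent K (Φ ∘ v)) :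
    LinearIndependent K (fun p : ι × ℕ => (T ^ p.2) (v p.1)) := by
  classical
  let := Module.addCommMonoidToAddCommGroup K (M := M)
  let := Module.addCommMonoidToAddCommGroup K (M := N)
  have key : ∀ (A : Finset ι) (n : ℕ) (g : ℕ → ι → K),
      ∑ r ∈ range n, (T ^ r) (∑ i ∈ A, g r i • v i) = 0 →
        ∀ r < n, ∀ i ∈ A, g r i = 0 := by
    intro A n
    induction n with
    | zero => intro g _ r hr; omega
    | succ n ih =>
      intro g hg
      have hshift : ∑ r ∈ range (n + 1), (T ^ r) (∑ i ∈ A, g r i • v i) =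
          T (∑ r ∈ range n, (T ^ r) (∑ i ∈ A, g (r + 1) i • v i)) + ∑ i ∈ A, g 0 i • v i := by
        rw [sum_range_succ', map_sum T]
        simp only [pow_succ', Module.End.mul_apply, pow_zero, Module.End.one_apply]
      rw [hshift] at hg
      have h0 : ∀ i ∈ A, g 0 i = 0 := by
        have := congrArg Φ hg
        rw [map_add, hΦ, zero_add, map_zero, map_sum] at this
        simp only [map_smul] at this
        exact linearIndependent_iff'.1 hv A (g 0) this
      have hrest : ∑ i ∈ A, g 0 i • v i = 0 :=
        sum_eq_zero fun i hi => by rw [h0 i hi, zero_smul]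
      rw [hrest, add_zero] at hg
      have h1 := ih (fun r => g (r + 1)) (hT (hg.trans (map_zero T).symm))
      intro r hr
      cases r with
      | zero => exact h0
      | succ r => exact h1 r (by omega)
  rw [linearIndependent_iff'']
  intro s g hs hg p
  by_cases hp : p ∈ s
  · have hsub : s ⊆ s.image Prod.fst ×ˢ range (s.sup Prod.snd + 1) := by
      intro x hx
      exact mem_product.2 ⟨mem_image_of_mem _ hx,
        mem_range.2 (Nat.lt_succ_of_le (le_sup (f := Prod.snd) hx))⟩
    refine key (s.image Prod.fst) (s.sup Prod.snd + 1) (fun r i => g (i, r)) ?_ p.2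
      (mem_range.1 (mem_product.1 (hsub hp)).2) p.1 (mem_product.1 (hsub hp)).1
    rw [sum_subset hsub fun x _ hx => by rw [hs x hx, zero_smul], sum_product_right] at hg
    simpa only [map_sum, map_smul] using hg
  · exact hs p hp

/-- The spans of the rows of a linearly independent spanning family indexed by a product give an
internal direct sum. -/
theorem isInternal_span_range_of_linearIndependent {K M ι κ : Type*} [DecidableEq ι] [Field K]
    [AddCommMonoid M] [Module K M] {f : ι × κ → M} (hf : LinearIndependent K f)
    (hspan : Submodule.span K (Set.range f) = ⊤) :
    DirectSum.IsInternal fun i : ι => Submodule.span K (Set.range fun r : κ => f (i, r)) := by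
  let := Module.addCommMonoidToAddCommGroup K (M := M)
  rw [DirectSum.isInternal_submodule_iff_iSupIndep_and_iSup_eq_top]
  constructor
  · intro i
    refine (hf.disjoint_span_image (s := {p | p.1 = i}) (t := {p | p.1 ≠ i}) ?_).mono ?_ ?_
    · exact Set.disjoint_left.2 fun p hp hp' => hp' hp
    · refine Submodule.span_mono ?_
      rintro _ ⟨r, rfl⟩
      exact ⟨(i, r), rfl, rfl⟩
    · refine iSup₂_le fun j hj => Submodule.span_mono ?_
      rintro _ ⟨r, rfl⟩
      exact ⟨(j, r), hj, rfl⟩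
  · rw [eq_top_iff, ← hspan, Submodule.span_le]
    rintro _ ⟨p, rfl⟩
    exact Submodule.mem_iSup_of_mem p.1 (Submodule.subset_span ⟨p.2, rfl⟩)

/-- The basis `|a⟩ ⊗ |b⟩` of `F ⊗ F`. -/
def ketBasis (K : Type) [Field K] : Module.Basis (ℕ × ℕ) K ((ℕ →₀ K) ⊗[K] (ℕ →₀ K)) :=
  Finsupp.basisSingleOne.tensorProduct Finsupp.basisSingleOne

theorem ketBasis_apply {K : Type} [Field K] (a b : ℕ) :
    ketBasis K (a, b) = Finsupp.single a (1 : K) ⊗ₜ[K] Finsupp.single b (1 : K) := by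
  simp [ketBasis, Module.Basis.tensorProduct_apply]

theorem Df1_ketBasis {K : Type} [Field K] (q α β : K) (a b : ℕ) :
    Df1 q α β (ketBasis K (a, b)) =
      ketBasis K (a + 1, b) + (α * q ^ (2 * (a : ℤ))) • ketBasis K (a, b + 1) := by
  have hs : Finsupp.single a (α * q ^ (2 * (a : ℤ))) =
      (α * q ^ (2 * (a : ℤ))) • Finsupp.single a (1 : K) := by simp
  simp only [ketBasis_apply, Df1, f1V, k1Vinv, opOf, LinearMap.add_apply, TensorProduct.map_tmul,
    Finsupp.lsum_single, LinearMap.toSpanSingleton_apply, one_smul, LinearMap.id_apply]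
  rw [hs, TensorProduct.smul_tmul']

/-- The value on `|a⟩ ⊗ |b⟩` of the functional that kills the range of `Δf₁`. -/
def coinvWeight {K : Type} [Field K] (q α : K) (a : ℕ) : K :=
  ∏ i ∈ range a, -(α * q ^ (2 * (i : ℤ)))

theorem coinvWeight_succ {K : Type} [Field K] (q α : K) (a : ℕ) :
    coinvWeight q α (a + 1) = -(α * q ^ (2 * (a : ℤ))) * coinvWeight q α a := by
  rw [coinvWeight, prod_range_succ, mul_comm, coinvWeight]

theorem coinvWeight_ne_zero {K : Type} [Field K] {q α : K} (hq : q ≠ 0) (hα : α ≠ 0) (a : ℕ) :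
    coinvWeight q α a ≠ 0 :=
  prod_ne_zero_iff.2 fun _ _ => neg_ne_zero.2 (mul_ne_zero hα (zpow_ne_zero _ hq))

/-- The graded projection of `F ⊗ F` onto its coinvariants under `Δf₁`. -/
def coinvMap {K : Type} [Field K] (q α : K) : (ℕ →₀ K) ⊗[K] (ℕ →₀ K) →ₗ[K] (ℕ →₀ K) :=
  (ketBasis K).constr K fun p => Finsupp.single (p.1 + p.2) (coinvWeight q α p.1)

theorem coinvMap_ketBasis {K : Type} [Field K] (q α : K) (a b : ℕ) :
    coinvMap q α (ketBasis K (a, b)) = Finsupp.single (a + b) (coinvWeight q α a) := by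
  rw [coinvMap, Module.Basis.constr_basis]

theorem coinvMap_Df1 {K : Type} [Field K] (q α β : K) (x : (ℕ →₀ K) ⊗[K] (ℕ →₀ K)) :
    coinvMap q α (Df1 q α β x) = 0 := by
  have h : coinvMap q α ∘ₗ Df1 q α β = 0 := by
    refine (ketBasis K).ext fun ⟨a, b⟩ => ?_
    rw [LinearMap.comp_apply, Df1_ketBasis, map_add, map_smul, coinvMap_ketBasis,
      coinvMap_ketBasis, coinvWeight_succ, Finsupp.smul_single, show a + 1 + b = a + (b + 1) by ring,
      ← Finsupp.single_add, smul_eq_mul, neg_mul, neg_add_cancel, Finsupp.single_zero,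
      LinearMap.zero_apply]
  exact LinearMap.congr_fun h x

theorem Df1_injective {K : Type} [Field K] {q α : K} (hq : q ≠ 0) (hα : α ≠ 0) (β : K) :
    Function.Injective (Df1 q α β) := by
  have hzero : ∀ b, (ketBasis K).coord (0, b + 1) ∘ₗ Df1 q α β =
      α • (ketBasis K).coord (0, b) := by
    refine fun b => (ketBasis K).ext fun ⟨a', b'⟩ => ?_
    rw [LinearMap.comp_apply, Df1_ketBasis]
    by_cases h : a' = 0 <;> simp [Finsupp.single_apply, h]
  have hsucc : ∀ a b, (ketBasis K).coord (a + 1, b + 1) ∘ₗ Df1 q α β =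
      (ketBasis K).coord (a, b + 1) +
        (α * q ^ (2 * ((a + 1 : ℕ) : ℤ))) • (ketBasis K).coord (a + 1, b) := by
    refine fun a b => (ketBasis K).ext fun ⟨a', b'⟩ => ?_
    rw [LinearMap.comp_apply, Df1_ketBasis]
    by_cases h : a' = a + 1
    · subst h
      by_cases h' : b' = b <;> simp [h']
    · simp [Finsupp.single_apply, h]
  rw [injective_iff_map_eq_zero]
  intro x hx
  have hcoord : ∀ a b, (ketBasis K).coord (a, b) x = 0 := by
    intro a
    induction a with
    | zero =>
      intro b
      have h := LinearMap.congr_fun (hzero b) x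
      rw [LinearMap.comp_apply, hx, map_zero, LinearMap.smul_apply, smul_eq_mul] at h
      exact (mul_eq_zero.1 h.symm).resolve_left hα
    | succ a ih =>
      intro b
      have h := LinearMap.congr_fun (hsucc a b) x
      rw [LinearMap.comp_apply, hx, map_zero, LinearMap.add_apply, ih, zero_add,
        LinearMap.smul_apply, smul_eq_mul] at h
      exact (mul_eq_zero.1 h.symm).resolve_left (mul_ne_zero hα (zpow_ne_zero _ hq))
  exact (ketBasis K).forall_coord_eq_zero_iff.1 fun p => hcoord p.1 p.2

/-- A `Δf₁`-stable subspace that contains, in each degree `d`, a homogeneous vector with nonzero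
image in the coinvariants is the whole space. -/
theorem eq_top_of_Df1_stable {K : Type} [Field K] (q α β : K) (c : ℕ → ℕ → K)
    (hc : ∀ d, ∑ j ∈ range (d + 1), c d j * coinvWeight q α (d - j) ≠ 0)
    (S : Submodule K ((ℕ →₀ K) ⊗[K] (ℕ →₀ K))) (hS : ∀ x ∈ S, Df1 q α β x ∈ S)
    (hv : ∀ d, ∑ j ∈ range (d + 1), c d j • ketBasis K (d - j, j) ∈ S) : S = ⊤ := by
  have step : ∀ n, (∀ a b, a + b + 1 = n → ketBasis K (a, b) ∈ S) →
      ∀ a b, a + b = n → ketBasis K (a, b) ∈ S := by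
    intro n ih
    have hmod : ∀ a b, a + b = n →
        ketBasis K (a, b) + (-coinvWeight q α a) • ketBasis K (0, n) ∈ S := by
      intro a
      induction a with
      | zero =>
        intro b hb
        obtain rfl : b = n := by omega
        convert S.zero_mem using 1
        rw [coinvWeight, prod_range_zero]
        module
      | succ a iha =>
        intro b hb
        have h1 := hS _ (ih a b (by omega))
        have h2 := S.smul_mem (-(α * q ^ (2 * (a : ℤ)))) (iha (b + 1) (by omega))
        rw [Df1_ketBasis] at h1
        convert S.add_mem h1 h2 using 1
        rw [coinvWeight_succ]
        module
    have h0 : ketBasis K (0, n) ∈ S := by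
      refine (S.smul_mem_iff (hc n)).1 ?_
      have h : ∑ j ∈ range (n + 1), c n j •
          (ketBasis K (n - j, j) + (-coinvWeight q α (n - j)) • ketBasis K (0, n)) ∈ S :=
        S.sum_mem fun j hj => S.smul_mem _
          (hmod _ _ (Nat.sub_add_cancel (Nat.lt_succ_iff.1 (mem_range.1 hj))))
      convert S.add_mem (hv n) (S.smul_mem (-1) h) using 1
      rw [smul_sum, ← sum_add_distrib, sum_smul]
      exact sum_congr rfl fun j _ => by module
    intro a b hab
    convert S.add_mem (hmod a b hab) (S.smul_mem (coinvWeight q α a) h0) using 1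
    module
  have hall : ∀ n a b, a + b = n → ketBasis K (a, b) ∈ S := by
    intro n
    induction n with
    | zero => exact step 0 fun a b h => by omega
    | succ n ih => exact step (n + 1) fun a b h => ih a b (by omega)
  rw [eq_top_iff, ← (ketBasis K).span_eq, Submodule.span_le]
  rintro _ ⟨⟨a, b⟩, rfl⟩
  exact hall _ a b rfl

/-- The coefficient of `|d-j⟩ ⊗ |j⟩` in `v^{(d)}_{α,β}`. -/
def vcoeff {K : Type} [Field K] (q α β : K) (d j : ℕ) : K :=
  (-(q ^ (1 - (d : ℤ)) * β⁻¹)) ^ j * qbinom (q ^ 2) d j *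
    ∏ k ∈ Icc 1 j, brace q (α * q ^ ((d : ℤ) - (k : ℤ))) / brace q (β * q ^ ((k : ℤ) - 1))

theorem vvec_eq_sum_ketBasis {K : Type} [Field K] (q α β : K) (d : ℕ) :
    vvec q α β d = ∑ j ∈ range (d + 1), vcoeff q α β d j • ketBasis K (d - j, j) := by
  simp only [vvec, vcoeff, ketBasis_apply]

theorem coinvMap_vvec {K : Type} [Field K] (q α β : K) (d : ℕ) :
    coinvMap q α (vvec q α β d) =
      (∑ j ∈ range (d + 1), vcoeff q α β d j * coinvWeight q α (d - j)) •
        Finsupp.single d (1 : K) := by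
  rw [vvec_eq_sum_ketBasis, map_sum, sum_smul]
  refine sum_congr rfl fun j hj => ?_
  rw [map_smul, coinvMap_ketBasis, Nat.sub_add_cancel (Nat.lt_succ_iff.1 (mem_range.1 hj))]
  simp

theorem linearIndependent_coinvMap_vvec {K : Type} [Field K] {q α β : K}
    (hc : ∀ d, ∑ j ∈ range (d + 1), vcoeff q α β d j * coinvWeight q α (d - j) ≠ 0) :
    LinearIndependent K (coinvMap q α ∘ vvec q α β) := by
  rw [linearIndependent_iff']
  intro s g hg i hi
  have h := DFunLike.congr_fun hg i
  simp only [Function.comp_apply, coinvMap_vvec, Finsupp.smul_single, smul_eq_mul, mul_one,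
    Finsupp.finsetSum_apply, Finsupp.single_apply, sum_ite_eq', hi, if_true,
    Finsupp.zero_apply] at h
  exact (mul_eq_zero.1 h).resolve_right (hc i)

theorem linearIndependent_Df1_pow_vvec {K : Type} [Field K] {q α β : K} (hq : q ≠ 0) (hα : α ≠ 0)
    (hc : ∀ d, ∑ j ∈ range (d + 1), vcoeff q α β d j * coinvWeight q α (d - j) ≠ 0) :
    LinearIndependent K (fun p : ℕ × ℕ => ((Df1 q α β) ^ p.2) (vvec q α β p.1)) :=
  linearIndependent_pow_apply (Df1_injective hq hα β) (coinvMap_Df1 q α β)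
    (linearIndependent_coinvMap_vvec hc)

theorem span_Df1_pow_vvec {K : Type} [Field K] {q α β : K}
    (hc : ∀ d, ∑ j ∈ range (d + 1), vcoeff q α β d j * coinvWeight q α (d - j) ≠ 0) :
    Submodule.span K
      (Set.range fun p : ℕ × ℕ => ((Df1 q α β) ^ p.2) (vvec q α β p.1)) = ⊤ := by
  refine eq_top_of_Df1_stable q α β _ hc _ (fun x hx => ?_) fun d => ?_
  · induction hx using Submodule.span_induction with
    | mem x hx =>
      obtain ⟨⟨d, r⟩, rfl⟩ := hx
      refine Submodule.subset_span ⟨(d, r + 1), ?_⟩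
      simp only [pow_succ', Module.End.mul_apply]
    | zero => rw [map_zero]; exact Submodule.zero_mem _
    | add x y _ _ hx hy => rw [map_add]; exact Submodule.add_mem _ hx hy
    | smul a x _ hx => rw [map_smul]; exact Submodule.smul_mem _ a hx
  · rw [← vvec_eq_sum_ketBasis]
    exact Submodule.subset_span ⟨(d, 0), rfl⟩

theorem isInternal_span_Df1_pow_vvec {K : Type} [Field K] {q α β : K} (hq : q ≠ 0) (hα : α ≠ 0)
    (hc : ∀ d, ∑ j ∈ range (d + 1), vcoeff q α β d j * coinvWeight q α (d - j) ≠ 0) :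
    DirectSum.IsInternal fun d : ℕ =>
      Submodule.span K (Set.range fun r : ℕ => ((Df1 q α β) ^ r) (vvec q α β d)) :=
  isInternal_span_range_of_linearIndependent
    (f := fun p : ℕ × ℕ => ((Df1 q α β) ^ p.2) (vvec q α β p.1))
    (linearIndependent_Df1_pow_vvec hq hα hc) (span_Df1_pow_vvec hc)

section InftyValuation

variable {F : Type} [Field F]

theorem inftyValuation_C_le_one [DecidableEq (RatFunc F)] (c : F) :
    RatFunc.inftyValuation F (RatFunc.C c) ≤ 1 := by
  by_cases hc : c = 0
  · simp [hc]
  · rw [RatFunc.inftyValuation.C F hc]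

theorem brace_C (q u : F) : brace (RatFunc.C q) (RatFunc.C u) = RatFunc.C (brace q u) := by
  simp [brace]

theorem poch_C (x p : F) (m : ℕ) :
    poch (RatFunc.C x) (RatFunc.C p) m = RatFunc.C (poch x p m) := by
  simp [poch]

theorem qbinom_C (p : F) (m n : ℕ) : qbinom (RatFunc.C p) m n = RatFunc.C (qbinom p m n) := by
  unfold qbinom
  split_ifs <;> simp [poch_C]

theorem coinvWeight_C (q α : F) (a : ℕ) :
    coinvWeight (RatFunc.C q) (RatFunc.C α) a = RatFunc.C (coinvWeight q α a) := by
  simp [coinvWeight]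

theorem one_lt_inftyValuation_brace [DecidableEq (RatFunc F)] {q c : F} (hq : q - q⁻¹ ≠ 0)
    (hc : c ≠ 0) :
    1 < RatFunc.inftyValuation F (brace (RatFunc.C q) (RatFunc.X * RatFunc.C c)) := by
  have hX : 1 < RatFunc.inftyValuation F (RatFunc.X * RatFunc.C c) := by
    rw [map_mul, RatFunc.inftyValuation.C F hc, mul_one, RatFunc.inftyValuation.X,
      ← WithZero.exp_zero, WithZero.exp_lt_exp]
    exact zero_lt_one
  have hinv : RatFunc.inftyValuation F (RatFunc.X * RatFunc.C c)⁻¹ < 1 := by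
    rw [map_inv₀]
    exact inv_lt_one_of_one_lt₀ hX
  rw [brace, ← map_inv₀ RatFunc.C, ← map_sub, map_div₀, RatFunc.inftyValuation.C F hq, div_one,
    Valuation.map_sub_eq_of_lt_left _ (hinv.trans hX)]
  exact hX

theorem inftyValuation_vcoeff_lt_one [DecidableEq (RatFunc F)] {q : F} (hq0 : q ≠ 0)
    (hq : q - q⁻¹ ≠ 0) (α : F) (d j : ℕ) (hj : j ≠ 0) :
    RatFunc.inftyValuation F (vcoeff (RatFunc.C q) (RatFunc.C α) RatFunc.X d j) < 1 := by
  have hX : RatFunc.inftyValuation F (RatFunc.X)⁻¹ < 1 := by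
    rw [map_inv₀, RatFunc.inftyValuation.X]
    refine inv_lt_one_of_one_lt₀ ?_
    rw [← WithZero.exp_zero, WithZero.exp_lt_exp]
    exact zero_lt_one
  rw [vcoeff, map_mul, map_mul]
  refine mul_lt_one_of_nonneg_of_lt_one_left zero_le (mul_lt_one_of_nonneg_of_lt_one_left zero_le ?_ ?_) ?_
  · rw [map_pow, Valuation.map_neg, map_mul, ← map_zpow₀]
    exact pow_lt_one₀ zero_le
      (mul_lt_one_of_nonneg_of_lt_one_right (inftyValuation_C_le_one _) zero_le hX) hj
  · rw [← map_pow, qbinom_C]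
    exact inftyValuation_C_le_one _
  · rw [map_prod]
    refine prod_le_one' fun k _ => ?_
    rw [← map_zpow₀, ← map_zpow₀, ← map_mul, brace_C, map_div₀]
    have h := one_lt_inftyValuation_brace hq (zpow_ne_zero ((k : ℤ) - 1) hq0)
    rw [div_eq_mul_inv]
    exact mul_le_one' (inftyValuation_C_le_one _) (inv_lt_one_of_one_lt₀ h).le

theorem sum_vcoeff_mul_coinvWeight_ne_zero {q α : F} (hq : q ≠ 0) (hα : α ≠ 0)
    (hroot : ∀ n : ℕ, n ≠ 0 → q ^ n ≠ 1) (d : ℕ) :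
    ∑ j ∈ range (d + 1), vcoeff (RatFunc.C q) (RatFunc.C α) RatFunc.X d j *
      coinvWeight (RatFunc.C q) (RatFunc.C α) (d - j) ≠ 0 := by
  classical
  have hq' : q - q⁻¹ ≠ 0 := fun h => hroot 2 two_ne_zero <| by
    rw [sq]
    nth_rewrite 2 [sub_eq_zero.1 h]
    exact mul_inv_cancel₀ hq
  have hpoch : poch (q ^ 2) (q ^ 2) d ≠ 0 := prod_ne_zero_iff.2 fun j _ => by
    rw [← pow_succ', ← pow_mul]
    exact sub_ne_zero.2 (hroot _ (by positivity)).symm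
  have h0 : vcoeff (RatFunc.C q) (RatFunc.C α) RatFunc.X d 0 = 1 := by
    rw [vcoeff, ← map_pow, qbinom_C, qbinom, if_pos d.zero_le, Nat.sub_zero,
      show poch (q ^ 2) (q ^ 2) 0 = 1 from prod_range_zero _, one_mul, div_self hpoch]
    simp
  have hlt : RatFunc.inftyValuation F (∑ j ∈ range d,
      vcoeff (RatFunc.C q) (RatFunc.C α) RatFunc.X d (j + 1) *
        coinvWeight (RatFunc.C q) (RatFunc.C α) (d - (j + 1))) < 1 := by
    refine Valuation.map_sum_lt _ one_ne_zero fun j _ => ?_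
    rw [map_mul, coinvWeight_C]
    exact mul_lt_one_of_nonneg_of_lt_one_left zero_le (inftyValuation_vcoeff_lt_one hq hq' α d _ j.succ_ne_zero)
      (inftyValuation_C_le_one _)
  have hone := RatFunc.inftyValuation.C F (coinvWeight_ne_zero hq hα d)
  rw [sum_range_succ', h0, one_mul, Nat.sub_zero, coinvWeight_C q α d]
  intro hsum
  have hval := Valuation.map_add_eq_of_lt_left _ (hlt.trans_eq hone.symm)
  rw [add_comm, hsum, hone, map_zero] at hval
  exact zero_ne_one hval

end InftyValuation

theorem basis_of_Df1_vvec :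
    LinearIndependent K9 (fun p : ℕ × ℕ => ((Df1 q9 α9 β9) ^ p.2) (vvec q9 α9 β9 p.1)) ∧
    Submodule.span K9
        (Set.range fun p : ℕ × ℕ => ((Df1 q9 α9 β9) ^ p.2) (vvec q9 α9 β9 p.1)) = ⊤ ∧
    DirectSum.IsInternal fun d : ℕ =>
      Submodule.span K9 (Set.range fun r : ℕ => ((Df1 q9 α9 β9) ^ r) (vvec q9 α9 β9 d)) := by
  have hq : RatFunc.C (RatFunc.X : RatFunc ℚ) ≠ 0 := by simp [RatFunc.X_ne_zero]
  have hroot : ∀ n : ℕ, n ≠ 0 → (RatFunc.C (RatFunc.X : RatFunc ℚ)) ^ n ≠ 1 := by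
    intro n hn h
    rw [← map_pow, ← map_one RatFunc.C] at h
    have hdeg := congrArg RatFunc.intDegree (RatFunc.C_injective h)
    rw [← RatFunc.algebraMap_X, ← map_pow, RatFunc.intDegree_polynomial, RatFunc.intDegree_one,
      Polynomial.natDegree_X_pow] at hdeg
    exact hn (by exact_mod_cast hdeg)
  have hq9 : q9 ≠ 0 := (map_ne_zero RatFunc.C).2 hq
  have hα9 : α9 ≠ 0 := (map_ne_zero RatFunc.C).2 RatFunc.X_ne_zero
  have hc : ∀ d, ∑ j ∈ range (d + 1), vcoeff q9 α9 β9 d j * coinvWeight q9 α9 (d - j) ≠ 0 :=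
    sum_vcoeff_mul_coinvWeight_ne_zero hq RatFunc.X_ne_zero hroot
  exact ⟨linearIndependent_Df1_pow_vvec hq9 hα9 hc, span_Df1_pow_vvec hc,
    isInternal_span_Df1_pow_vvec hq9 hα9 hc⟩
end
end
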